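/- In a pointed pseudo-triangulation, for any vertex v of degree three, flipping one of the two edges incident to the reflex angle at v results in an edge not incident to v, thereby decreasing the degree of v to two. -/

import Mathlib

open scoped RealInnerProductSpace Classical

/-- Points in the Euclidean plane. -/
abbrev Pt := EuclideanSpace ℝ (Fin 2)

/-- The closed segment spanned by an unordered pair of points. -/
noncomputable def seg (e : Sym2 Pt) : Set Pt :=
  Sym2.lift ⟨fun p q => segment ℝ p q, fun p q => segment_symm ℝ p q⟩ e

/-- The open segment spanned by an unordered pair of points. -/
noncomputable def oseg (e : Sym2 Pt) : Set Pt :=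
  Sym2.lift ⟨fun p q => openSegment ℝ p q, fun p q => openSegment_symm ℝ p q⟩ e

/-- A plane straight-line graph on a finite point set `P`. -/
structure PlaneGraph (P : Finset Pt) where
  edges : Finset (Sym2 Pt)
  not_isDiag : ∀ e ∈ edges, ¬ e.IsDiag
  endpoints_mem : ∀ e ∈ edges, ∀ p ∈ e, p ∈ P
  noncrossing : ∀ e ∈ edges, ∀ f ∈ edges, e ≠ f → oseg e ∩ oseg f = ∅
  no_vertex_interior : ∀ e ∈ edges, ∀ p ∈ P, p ∉ oseg e

/-- `v` is pointed: all edges at `v` lie strictly inside an open half-plane. -/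
def PointedAt {P : Finset Pt} (G : PlaneGraph P) (v : Pt) : Prop :=
  ∃ u : Pt, ∀ e ∈ G.edges, v ∈ e → ∀ w ∈ e, w ≠ v → 0 < ⟪u, w - v⟫

def PointedGraph {P : Finset Pt} (G : PlaneGraph P) : Prop := ∀ v ∈ P, PointedAt G v

/-- Pointed pseudo-triangulation = maximal pointed plane straight-line graph (Streinu). -/
def IsPointedPseudoTriangulation {P : Finset Pt} (G : PlaneGraph P) : Prop :=
  PointedGraph G ∧ ∀ G' : PlaneGraph P, PointedGraph G' → G.edges ⊆ G'.edges → G'.edges = G.edges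

def GeneralPosition (P : Finset Pt) : Prop :=
  ∀ p ∈ P, ∀ q ∈ P, ∀ r ∈ P, p ≠ q → p ≠ r → q ≠ r → ¬ Collinear ℝ ({p, q, r} : Set Pt)

/-- The vertices of `P` on its convex hull boundary. -/
noncomputable def hullVertices (P : Finset Pt) : Finset Pt :=
  P.filter fun p => p ∈ frontier (convexHull ℝ (P : Set Pt))

/-- The internal (non-convex-hull) edges of a plane graph. -/
noncomputable def internalEdges {P : Finset Pt} (G : PlaneGraph P) : Finset (Sym2 Pt) :=
  G.edges.filter fun e => ¬ (seg e ⊆ frontier (convexHull ℝ (P : Set Pt)))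

/-- An exchanging flip between pointed pseudo-triangulations: the internal edge `e` is
removed, leaving a pseudo-quadrilateral, and the unique other bitangent `e'` is
inserted. -/
def PPTFlip {P : Finset Pt} (G G' : PlaneGraph P) (e e' : Sym2 Pt) : Prop :=
  IsPointedPseudoTriangulation G ∧ IsPointedPseudoTriangulation G' ∧
    e ∈ G.edges ∧ e' ∉ G.edges ∧ G'.edges = insert e' (G.edges.erase e)

/-- `e` is one of the (at most two) edges at `v` incident to the reflex angle at `v`:
it is extremal in the angular order, i.e. it lies on the boundary of an open half-plane
strictly containing all other edges at `v`. -/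
def IncidentToReflexAngle {P : Finset Pt} (G : PlaneGraph P) (v : Pt) (e : Sym2 Pt) : Prop :=
  e ∈ G.edges ∧ v ∈ e ∧ ∃ u : Pt, u ≠ 0 ∧
    (∀ w ∈ e, w ≠ v → ⟪u, w - v⟫ = 0) ∧
    ∀ f ∈ G.edges, v ∈ f → f ≠ e → ∀ w ∈ f, w ≠ v → 0 < ⟪u, w - v⟫

/-- The planar cross product. -/
def det2 (a b : Pt) : ℝ := a 0 * b 1 - a 1 * b 0

/-- Rotation by a quarter turn. -/
noncomputable def perp (a : Pt) : Pt := !₂[-a 1, a 0]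

lemma inner_eq_coord (a b : Pt) : ⟪a, b⟫ = a 0 * b 0 + a 1 * b 1 := by
  simp [PiLp.inner_apply, Fin.sum_univ_two, mul_comm]

@[simp] lemma perp_zero_coord (a : Pt) : perp a 0 = -a 1 := rfl

@[simp] lemma perp_one_coord (a : Pt) : perp a 1 = a 0 := rfl

lemma pt_ext {a b : Pt} (h0 : a 0 = b 0) (h1 : a 1 = b 1) : a = b := by
  ext i; fin_cases i <;> assumption

lemma inner_perp (a b : Pt) : ⟪perp a, b⟫ = det2 a b := by
  rw [inner_eq_coord, det2]; simp; ring

lemma inner_self_pos_of_ne {a : Pt} (h : a ≠ 0) : 0 < ⟪a, a⟫ :=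
  real_inner_self_pos.2 h

lemma det2_perp_neg (a b : Pt) : det2 (-perp a) b = ⟪a, b⟫ := by
  rw [inner_eq_coord, det2]; simp; ring

lemma perp_ne_zero {a : Pt} (h : a ≠ 0) : perp a ≠ 0 := by
  intro h'
  apply h
  have h0 := congrFun (congrArg (fun x : Pt => (x : Fin 2 → ℝ)) h') 0
  have h1 := congrFun (congrArg (fun x : Pt => (x : Fin 2 → ℝ)) h') 1
  simp at h0 h1
  exact pt_ext (by simpa using h1) (by simpa using h0)

/-- The quadratic relation between the cross products of four vectors. -/
lemma det2_plucker (a b c d : Pt) :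
    det2 a b * det2 c d = det2 c a * det2 d b - det2 c b * det2 d a := by
  simp only [det2]; ring

lemma det2_cramer (a b c : Pt) :
    det2 a b • c + det2 b c • a + det2 c a • b = 0 := by
  apply pt_ext <;> simp [det2] <;> ring

lemma det2_comm (a b : Pt) : det2 a b = -det2 b a := by simp only [det2]; ring

@[simp] lemma det2_self (a : Pt) : det2 a a = 0 := by simp only [det2]; ring

lemma eq_smul_of_det2_eq_zero {a b : Pt} (ha : a ≠ 0) (h : det2 a b = 0) :
    ∃ c : ℝ, b = c • a := by
  refine ⟨⟪a, b⟫ / ⟪a, a⟫, ?_⟩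
  have hp := inner_self_pos_of_ne ha
  have h2 : ⟪a, a⟫ • b = ⟪a, b⟫ • a := by
    simp only [det2] at h
    rw [inner_eq_coord, inner_eq_coord]
    apply pt_ext
    · simp only [PiLp.smul_apply, smul_eq_mul]; linear_combination (-a 1) * h
    · simp only [PiLp.smul_apply, smul_eq_mul]; linear_combination (a 0) * h
  rw [div_eq_inv_mul, mul_smul, ← h2, smul_smul, inv_mul_cancel₀ hp.ne', one_smul]

lemma det2_ne_zero_of_generalPosition {P : Finset Pt} (hgen : GeneralPosition P) {p q r : Pt}
    (hp : p ∈ P) (hq : q ∈ P) (hr : r ∈ P) (hpq : p ≠ q) (hpr : p ≠ r) (hqr : q ≠ r) :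
    det2 (q - p) (r - p) ≠ 0 := by
  intro h
  obtain ⟨c, hc⟩ := eq_smul_of_det2_eq_zero (sub_ne_zero.2 hpq.symm) h
  refine hgen p hp q hq r hr hpq hpr hqr ?_
  rw [collinear_iff_of_mem (p₀ := p) (by simp)]
  refine ⟨q - p, ?_⟩
  intro x hx
  simp only [Set.mem_insert_iff, Set.mem_singleton_iff] at hx
  rcases hx with rfl | rfl | rfl
  · exact ⟨0, by simp⟩
  · exact ⟨1, by simp⟩
  · exact ⟨c, by simp [← hc]⟩

/-- The rate of change of half the squared length of a segment under a motion. -/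
noncomputable def stretch (e : Sym2 Pt) : (Pt → Pt) →ₗ[ℝ] ℝ :=
  Sym2.lift ⟨fun p q => (innerₛₗ ℝ (p - q)) ∘ₗ
    (LinearMap.proj (R := ℝ) (φ := fun _ : Pt => Pt) p - LinearMap.proj q), by
      intro p q
      ext m
      simp only [LinearMap.comp_apply, LinearMap.sub_apply, LinearMap.proj_apply,
        innerₛₗ_apply_apply]
      rw [← neg_sub q p, ← neg_sub (m q) (m p), inner_neg_neg]⟩ e

lemma stretch_mk (p q : Pt) (m : Pt → Pt) : stretch s(p, q) m = ⟪p - q, m p - m q⟫ := rfl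

/-- All non-degenerate segments between points of `P`. -/
noncomputable def pairs (P : Finset Pt) : Finset (Sym2 Pt) := P.sym2.filter fun e => ¬ e.IsDiag

lemma mk_mem_pairs {P : Finset Pt} {p q : Pt} : s(p, q) ∈ pairs P ↔ p ∈ P ∧ q ∈ P ∧ p ≠ q := by
  simp [pairs, and_assoc]

/-- Sums over ordered pairs count every unordered pair twice. -/
lemma sum_sum_eq_two_mul_sum_pairs (P : Finset Pt) (g : Sym2 Pt → ℝ) (hg : ∀ p, g s(p, p) = 0) :
    ∑ p ∈ P, ∑ q ∈ P, g s(p, q) = 2 * ∑ e ∈ pairs P, g e := by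
  have h1 : ∑ p ∈ P, ∑ q ∈ P, g s(p, q) = ∑ x ∈ P.offDiag, g (Sym2.mk x.1 x.2) := by
    rw [← Finset.sum_product', ← Finset.diag_union_offDiag,
      Finset.sum_union (Finset.disjoint_diag_offDiag P)]
    rw [Finset.sum_eq_zero (s := P.diag), zero_add]
    rintro ⟨a, b⟩ h
    have hab : a = b := (Finset.mem_diag.1 h).2
    subst hab
    exact hg a
  have h2 : ∀ x ∈ P.offDiag, Sym2.mk x.1 x.2 ∈ pairs P := by
    rintro ⟨a, b⟩ h
    simpa [mk_mem_pairs] using h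
  rw [h1, ← Finset.sum_fiberwise_of_maps_to h2, Finset.mul_sum]
  refine Finset.sum_congr rfl fun e he => ?_
  induction e with | _ p q
  obtain ⟨hp, hq, hpq⟩ := mk_mem_pairs.1 he
  have : P.offDiag.filter (fun x => Sym2.mk x.1 x.2 = s(p, q)) = {(p, q), (q, p)} := by
    ext ⟨a, b⟩
    simp only [Finset.mem_filter, Finset.mem_offDiag, Finset.mem_insert, Finset.mem_singleton,
      Prod.mk.injEq, Sym2.eq_iff]
    constructor
    · exact fun h => h.2
    · rintro (⟨rfl, rfl⟩ | ⟨rfl, rfl⟩)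
      · exact ⟨⟨hp, hq, hpq⟩, Or.inl ⟨rfl, rfl⟩⟩
      · exact ⟨⟨hq, hp, hpq.symm⟩, Or.inr ⟨rfl, rfl⟩⟩
  rw [this, Finset.sum_pair (by simp [hpq])]
  rw [Sym2.eq_swap (a := q)]
  ring

/-- A self-stress of the complete geometric graph on `P`. -/
def IsStress (P : Finset Pt) (ω : Sym2 Pt → ℝ) : Prop :=
  ∀ m : Pt → Pt, ∑ e ∈ pairs P, ω e * stretch e m = 0

lemma IsStress.sum_sum {P : Finset Pt} {ω : Sym2 Pt → ℝ} (h : IsStress P ω) (m : Pt → Pt) :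
    ∑ p ∈ P, ∑ q ∈ P, ω s(p, q) * ⟪p - q, m p - m q⟫ = 0 := by
  have := sum_sum_eq_two_mul_sum_pairs P (fun e => ω e * stretch e m)
    (fun p => by simp [stretch_mk])
  rw [h m, mul_zero] at this
  exact this

/-- A rotation field with variable speed turns equilibrium into a balance of moments. -/
lemma IsStress.sum_moment {P : Finset Pt} {ω : Sym2 Pt → ℝ} (h : IsStress P ω) (x : Pt)
    (s : Pt → ℝ) :
    ∑ p ∈ P, ∑ q ∈ P, ω s(p, q) * ((s p - s q) * max 0 (det2 (p - x) (q - x))) = 0 := by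
  have h1 := h.sum_sum (fun p => s p • perp (p - x))
  have h2 : ∀ p q : Pt, ω s(p, q) * ⟪p - q, s p • perp (p - x) - s q • perp (q - x)⟫
      = -(ω s(p, q) * ((s p - s q) * max 0 (det2 (p - x) (q - x))))
        - (ω s(q, p) * ((s q - s p) * max 0 (det2 (q - x) (p - x)))) := by
    intro p q
    rw [det2_comm (q - x), Sym2.eq_swap (a := q)]
    have : ⟪p - q, s p • perp (p - x) - s q • perp (q - x)⟫
        = (s q - s p) * det2 (p - x) (q - x) := by
      simp [inner_eq_coord, det2]; ring
    rw [this]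
    have h3 : det2 (p - x) (q - x)
        = max 0 (det2 (p - x) (q - x)) - max 0 (-det2 (p - x) (q - x)) := by
      rcases le_total 0 (det2 (p - x) (q - x)) with h | h
      · rw [max_eq_right h, max_eq_left (by linarith)]; ring
      · rw [max_eq_left h, max_eq_right (by linarith)]; ring
    linear_combination ω s(p, q) * (s q - s p) * h3
  simp only [h2, Finset.sum_sub_distrib, Finset.sum_neg_distrib] at h1
  rw [Finset.sum_comm (f := fun p q => ω s(q, p) * ((s q - s p) *
    max 0 (det2 (q - x) (p - x))))] at h1
  linarith

/-- The contribution of the directed segment from `p` to `q` to the moment about `x` of the forces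
crossing the ray from `x` in direction `d`. -/
noncomputable def moment (d x p q : Pt) : ℝ :=
  if det2 d (p - x) < 0 ∧ 0 ≤ det2 d (q - x) then max 0 (det2 (p - x) (q - x)) else 0

/-- The Maxwell lifting of a stress, computed by cutting along rays of direction `d`. -/
noncomputable def lifting (P : Finset Pt) (ω : Sym2 Pt → ℝ) (d x : Pt) : ℝ :=
  ∑ p ∈ P, ∑ q ∈ P, ω s(p, q) * moment d x p q

lemma lifting_eq_of_det2_pos {P : Finset Pt} {ω : Sym2 Pt → ℝ} (h : IsStress P ω) (x : Pt)
    {d d' : Pt} (hd : 0 < det2 d d') : lifting P ω d x = lifting P ω d' x := by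
  rw [← sub_eq_zero, lifting, lifting, ← neg_eq_zero]
  rw [← h.sum_moment x
    (fun p => if 0 ≤ det2 d (p - x) ∧ det2 d' (p - x) < 0 then 1 else 0)]
  simp only [← Finset.sum_sub_distrib, ← Finset.sum_neg_distrib]
  refine Finset.sum_congr rfl fun p _ => Finset.sum_congr rfl fun q _ => ?_
  rw [← mul_sub, ← mul_neg]
  congr 1
  simp only [moment]
  have key := det2_plucker (p - x) (q - x) d d'
  rcases le_or_gt (det2 (p - x) (q - x)) 0 with h0 | h0
  · rw [max_eq_left h0]; simp
  rw [max_eq_right h0.le]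
  have hk : 0 < det2 (p - x) (q - x) * det2 d d' := mul_pos h0 hd
  rw [key] at hk
  generalize det2 (p - x) (q - x) = D at *
  generalize det2 d (p - x) = A at *
  generalize det2 d' (p - x) = A' at *
  generalize det2 d (q - x) = B at *
  generalize det2 d' (q - x) = B' at *
  rcases lt_or_ge A 0 with h1 | h1 <;> rcases lt_or_ge A' 0 with h2 | h2 <;>
    rcases lt_or_ge B 0 with h3 | h3 <;> rcases lt_or_ge B' 0 with h4 | h4 <;>
    simp [h1, h2, h3, h4, not_lt.2, not_le.2] <;> nlinarith

lemma lifting_eq {P : Finset Pt} {ω : Sym2 Pt → ℝ} (h : IsStress P ω) (x : Pt)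
    {d d' : Pt} (hd : d ≠ 0) (hd' : d' ≠ 0) : lifting P ω d x = lifting P ω d' x := by
  have aux : ∀ {a b : Pt}, det2 a b ≠ 0 → lifting P ω a x = lifting P ω b x := by
    intro a b hab
    rcases hab.lt_or_gt with h1 | h1
    · exact (lifting_eq_of_det2_pos h x (by rw [det2_comm]; linarith)).symm
    · exact lifting_eq_of_det2_pos h x h1
  by_cases hc : det2 d d' = 0
  · obtain ⟨c, rfl⟩ := eq_smul_of_det2_eq_zero hd hc
    have hc0 : c ≠ 0 := by rintro rfl; simp at hd'
    have hpos := inner_self_pos_of_ne hd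
    rw [aux (a := d) (b := perp d), aux (a := perp d)]
    · have : det2 (perp d) (c • d) = -(c * ⟪d, d⟫) := by
        rw [inner_eq_coord]; simp [det2]; ring
      rw [this]
      exact neg_ne_zero.2 (mul_ne_zero hc0 hpos.ne')
    · have : det2 d (perp d) = ⟪d, d⟫ := by
        rw [inner_eq_coord]; simp [det2]
      rw [this]; exact hpos.ne'
  · exact aux hc

open Filter Topology

/-- The change of slope at `q` of the moment along the direction `d`. -/
noncomputable def kink (d q p p' : Pt) : ℝ :=
  if det2 d (p - q) < 0 ∧ 0 ≤ det2 d (p' - q) ∧ det2 (p - q) (p' - q) = 0 then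
    det2 d (p' - q) - det2 d (p - q) else 0

lemma det2_sub_add_smul_self (d a q : Pt) (t : ℝ) :
    det2 d (a - (q + t • d)) = det2 d (a - q) := by
  simp [det2]; ring

lemma det2_sub_add_smul (d a b q : Pt) (t : ℝ) :
    det2 (a - (q + t • d)) (b - (q + t • d))
      = det2 (a - q) (b - q) - t * (det2 d (b - q) - det2 d (a - q)) := by
  simp [det2]; ring

lemma moment_second_difference (d q p p' : Pt) :
    ∀ᶠ t : ℝ in 𝓝[>] 0, moment d (q + t • d) p p' + moment d (q + (-t) • d) p p'
      - 2 * moment d q p p' = t * kink d q p p' := by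
  by_cases hσ : det2 d (p - q) < 0 ∧ 0 ≤ det2 d (p' - q)
  swap
  · filter_upwards with t
    simp only [moment, kink, det2_sub_add_smul_self]
    rw [if_neg hσ, if_neg hσ, if_neg hσ, if_neg (fun h => hσ ⟨h.1, h.2.1⟩)]
    ring
  simp only [moment, kink, det2_sub_add_smul_self, det2_sub_add_smul, if_pos hσ]
  set k := det2 d (p' - q) - det2 d (p - q) with hk
  have hk0 : 0 < k := by linarith [hσ.1, hσ.2]
  generalize hD : det2 (p - q) (p' - q) = D
  rcases lt_trichotomy D 0 with h | h | h
  · have : Set.Ioo (0 : ℝ) (-D / k) ∈ 𝓝[>] (0 : ℝ) :=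
      Ioo_mem_nhdsGT (div_pos (by linarith) hk0)
    filter_upwards [this] with t ht
    have h1 : t * k < -D := (lt_div_iff₀ hk0).1 ht.2
    have h2 : 0 < t * k := mul_pos ht.1 hk0
    rw [max_eq_left (by linarith), max_eq_left (by linarith), max_eq_left (by linarith),
      if_neg (fun h' => h.ne h'.2.2)]
    ring
  · filter_upwards [self_mem_nhdsWithin] with t ht
    have h2 : 0 < t * k := mul_pos ht hk0
    rw [max_eq_left (by linarith), max_eq_right (by linarith), max_eq_left (by linarith),
      if_pos ⟨hσ.1, hσ.2, h⟩]
    linarith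
  · have : Set.Ioo (0 : ℝ) (D / k) ∈ 𝓝[>] (0 : ℝ) :=
      Ioo_mem_nhdsGT (div_pos (by linarith) hk0)
    filter_upwards [this] with t ht
    have h1 : t * k < D := (lt_div_iff₀ hk0).1 ht.2
    have h2 : 0 < t * k := mul_pos ht.1 hk0
    rw [max_eq_right (by linarith), max_eq_right (by linarith), max_eq_right (by linarith),
      if_neg (fun h' => h.ne' h'.2.2)]
    ring

lemma lifting_second_difference (P : Finset Pt) (ω : Sym2 Pt → ℝ) (d q : Pt) :
    ∀ᶠ t : ℝ in 𝓝[>] 0, lifting P ω d (q + t • d) + lifting P ω d (q + (-t) • d)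
      - 2 * lifting P ω d q = t * ∑ p ∈ P, ∑ p' ∈ P, ω s(p, p') * kink d q p p' := by
  have h : ∀ᶠ t : ℝ in 𝓝[>] 0, ∀ p ∈ P, ∀ p' ∈ P,
      moment d (q + t • d) p p' + moment d (q + (-t) • d) p p'
      - 2 * moment d q p p' = t * kink d q p p' :=
    (Finset.eventually_all P).2 fun p _ => (Finset.eventually_all P).2 fun p' _ =>
      moment_second_difference d q p p'
  filter_upwards [h] with t ht
  simp only [lifting, Finset.mul_sum, ← Finset.sum_add_distrib, ← Finset.sum_sub_distrib]
  refine Finset.sum_congr rfl fun p hp => Finset.sum_congr rfl fun p' hp' => ?_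
  linear_combination ω s(p, p') * ht p hp p' hp'

lemma coordVec_ne_zero (t : ℝ) : (!₂[1, t] : Pt) ≠ 0 := by
  intro h
  have := congrArg (fun x : Pt => x 0) h
  simp at this

/-- The Maxwell lifting of a stress. -/
noncomputable def height (P : Finset Pt) (ω : Sym2 Pt → ℝ) (x : Pt) : ℝ :=
  lifting P ω !₂[1, 0] x

lemma height_eq {P : Finset Pt} {ω : Sym2 Pt → ℝ} (h : IsStress P ω) {d : Pt} (hd : d ≠ 0)
    (x : Pt) : height P ω x = lifting P ω d x :=
  lifting_eq h x (coordVec_ne_zero 0) hd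

lemma height_linear (P : Finset Pt) (ω τ : Sym2 Pt → ℝ) (a b : ℝ) (x : Pt) :
    height P (fun e => a * ω e + b * τ e) x = a * height P ω x + b * height P τ x := by
  simp only [height, lifting, Finset.mul_sum, ← Finset.sum_add_distrib]
  refine Finset.sum_congr rfl fun p _ => Finset.sum_congr rfl fun q _ => ?_
  ring

lemma exists_generic_direction (P : Finset Pt) (x : Pt) :
    ∃ d : Pt, d ≠ 0 ∧ ∀ p ∈ P, p ≠ x → det2 d (p - x) ≠ 0 := by
  obtain ⟨t, ht⟩ := Infinite.exists_notMem_finset (P.image fun p => (p - x) 1 / (p - x) 0)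
  refine ⟨!₂[1, t], coordVec_ne_zero t, fun p hp hpx h => ?_⟩
  have h' : (p - x) 1 = t * (p - x) 0 := by
    simp only [det2] at h
    simp at h ⊢
    linarith
  by_cases h0 : (p - x) 0 = 0
  · apply hpx
    rw [← sub_eq_zero]
    exact pt_ext h0 (by rw [h', h0]; simp)
  · exact ht (Finset.mem_image.2 ⟨p, hp, by rw [h']; field_simp⟩)

lemma continuous_det2_sub (d p : Pt) : Continuous fun x : Pt => det2 d (p - x) := by
  simp only [det2]; simp only [PiLp.sub_apply]; fun_prop

lemma continuous_det2_sub_sub (p q : Pt) : Continuous fun x : Pt => det2 (p - x) (q - x) := by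
  simp only [det2]; simp only [PiLp.sub_apply]; fun_prop

lemma continuousAt_moment {d x p q : Pt} (hp : p ≠ x → det2 d (p - x) ≠ 0)
    (hq : q ≠ x → det2 d (q - x) ≠ 0) : ContinuousAt (fun y => moment d y p q) x := by
  have hD := continuous_det2_sub_sub p q
  by_cases h0 : det2 (p - x) (q - x) = 0
  · have hx : moment d x p q = 0 := by simp [moment, h0]
    rw [ContinuousAt, hx]
    have h1 : Tendsto (fun y => |det2 (p - y) (q - y)|) (𝓝 x) (𝓝 0) := by
      have := hD.abs.tendsto x
      simpa [h0] using this
    refine squeeze_zero_norm (fun y => ?_) h1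
    rw [Real.norm_eq_abs, moment]
    split_ifs
    · rw [abs_of_nonneg (le_max_left _ _)]
      exact max_le (abs_nonneg _) (le_abs_self _)
    · simp
  · have hp' : det2 d (p - x) ≠ 0 := hp (by rintro rfl; simp [det2] at h0)
    have hq' : det2 d (q - x) ≠ 0 := hq (by rintro rfl; simp [det2] at h0)
    have sgn : ∀ r : Pt, det2 d (r - x) ≠ 0 →
        ∀ᶠ y in 𝓝 x, (det2 d (r - y) < 0 ↔ det2 d (r - x) < 0) := by
      intro r hr
      have hc := (continuous_det2_sub d r).tendsto x
      rcases hr.lt_or_gt with h | h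
      · filter_upwards [hc.eventually_lt_const h] with y hy using iff_of_true hy h
      · filter_upwards [hc.eventually_const_lt h] with y hy using
          iff_of_false hy.not_gt h.not_gt
    by_cases hc : det2 d (p - x) < 0 ∧ 0 ≤ det2 d (q - x)
    · have he : (fun y => max 0 (det2 (p - y) (q - y))) =ᶠ[𝓝 x] fun y => moment d y p q := by
        filter_upwards [sgn p hp', sgn q hq'] with y h1 h2
        rw [moment, if_pos]
        rwa [h1, ← not_lt, h2, not_lt]
      exact (continuous_const.max hD).continuousAt.congr he
    · have he : (fun _ => (0 : ℝ)) =ᶠ[𝓝 x] fun y => moment d y p q := by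
        filter_upwards [sgn p hp', sgn q hq'] with y h1 h2
        rw [moment, if_neg]
        rwa [h1, ← not_lt, h2, not_lt]
      exact continuousAt_const.congr he

lemma continuous_height {P : Finset Pt} {ω : Sym2 Pt → ℝ} (h : IsStress P ω) :
    Continuous (height P ω) := by
  rw [continuous_iff_continuousAt]
  intro x
  obtain ⟨d, hd, hd'⟩ := exists_generic_direction P x
  have : height P ω = fun x => lifting P ω d x := funext fun x => height_eq h hd x
  rw [this]
  simp only [lifting]
  exact tendsto_finsetSum _ fun p hp => tendsto_finsetSum _ fun q hq =>
    (continuousAt_moment (hd' p hp) (hd' q hq)).const_mul _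

lemma height_eq_zero_of_norm_le {P : Finset Pt} {ω : Sym2 Pt → ℝ} (h : IsStress P ω) {x : Pt}
    (hx : ∀ p ∈ P, ‖p‖ ≤ ‖x‖) : height P ω x = 0 := by
  have main : ∃ d : Pt, d ≠ 0 ∧ ∀ p ∈ P, 0 ≤ det2 d (p - x) := by
    by_cases hx0 : x = 0
    · subst hx0
      refine ⟨!₂[1, 0], coordVec_ne_zero 0, fun p hp => ?_⟩
      have := hx p hp
      rw [norm_zero, norm_le_zero_iff] at this
      simp [this, det2]
    · refine ⟨perp x, perp_ne_zero hx0, fun p hp => ?_⟩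
      have h1 : det2 (perp x) (p - x) = ⟪x, x⟫ - ⟪x, p⟫ := by
        rw [inner_eq_coord, inner_eq_coord]; simp [det2]; ring
      rw [h1, real_inner_self_eq_norm_sq]
      have := real_inner_le_norm x p
      nlinarith [norm_nonneg x, hx p hp]
  obtain ⟨d, hd, hd'⟩ := main
  rw [height_eq h hd, lifting]
  refine Finset.sum_eq_zero fun p hp => Finset.sum_eq_zero fun q hq => ?_
  rw [moment, if_neg, mul_zero]
  exact fun hh => absurd hh.1 (not_lt.2 (hd' p hp))

lemma height_second_difference {P : Finset Pt} {ω : Sym2 Pt → ℝ} (h : IsStress P ω) {d : Pt}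
    (hd : d ≠ 0) (q : Pt) : ∃ t : ℝ, 0 < t ∧
      height P ω (q + t • d) + height P ω (q + (-t) • d) - 2 * height P ω q
        = t * ∑ p ∈ P, ∑ p' ∈ P, ω s(p, p') * kink d q p p' := by
  obtain ⟨t, ht, ht0⟩ := ((lifting_second_difference P ω d q).and self_mem_nhdsWithin).exists
  refine ⟨t, ht0, ?_⟩
  simp only [height_eq h hd]
  exact ht

/-- A positive maximum of the lifting is attained at an extreme point of the maximizing set. -/
lemma exists_height_max {P : Finset Pt} {ω : Sym2 Pt → ℝ} (h : IsStress P ω) {x : Pt}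
    (hx : 0 < height P ω x) : ∃ q, 0 < height P ω q ∧ (∀ y, height P ω y ≤ height P ω q) ∧
      ∀ y, height P ω y = height P ω q → ‖y‖ ≤ ‖q‖ := by
  obtain ⟨R, hR⟩ : ∃ R : ℝ, ∀ p ∈ P, ‖p‖ ≤ R := by
    obtain ⟨R, hR⟩ := (P.image fun p => ‖p‖).bddAbove
    exact ⟨R, fun p hp => hR (by simpa using ⟨p, hp, rfl⟩)⟩
  have hout : ∀ y, 0 < height P ω y → y ∈ Metric.closedBall (0 : Pt) R := by
    intro y hy
    by_contra hy'
    rw [mem_closedBall_zero_iff, not_le] at hy'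
    exact hy.ne' (height_eq_zero_of_norm_le h fun p hp => (hR p hp).trans hy'.le)
  have hc := continuous_height h
  obtain ⟨z, -, hz⟩ := (isCompact_closedBall (0 : Pt) R).exists_isMaxOn ⟨x, hout x hx⟩
    hc.continuousOn
  have hz0 : 0 < height P ω z := hx.trans_le (hz (hout x hx))
  have hz' : ∀ y, height P ω y ≤ height P ω z := by
    intro y
    rcases le_or_gt (height P ω y) 0 with hy | hy
    · exact hy.trans hz0.le
    · exact hz (hout y hy)
  have hK : IsCompact {y | height P ω y = height P ω z} := by
    refine (isCompact_closedBall (0 : Pt) R).of_isClosed_subset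
      (isClosed_eq hc continuous_const) ?_
    intro y hy
    have hy' : height P ω y = height P ω z := hy
    exact hout y (by rw [hy']; exact hz0)
  obtain ⟨q, hq, hqm⟩ := hK.exists_isMaxOn ⟨z, rfl⟩ continuous_norm.continuousOn
  have hq' : height P ω q = height P ω z := hq
  refine ⟨q, by rw [hq']; exact hz0, by rw [hq']; exact hz', fun y hy => hqm ?_⟩
  exact hy.trans hq'

lemma exists_neg_kink_of_max {P : Finset Pt} {ω : Sym2 Pt → ℝ} (h : IsStress P ω) {q d : Pt}
    (hd : d ≠ 0) (hq : ∀ y, height P ω y ≤ height P ω q)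
    (hq' : ∀ y, height P ω y = height P ω q → ‖y‖ ≤ ‖q‖) :
    ∃ p ∈ P, ∃ p' ∈ P, ω s(p, p') * kink d q p p' < 0 := by
  by_contra! hneg
  obtain ⟨t, ht, h2⟩ := height_second_difference h hd q
  have hS : 0 ≤ t * ∑ p ∈ P, ∑ p' ∈ P, ω s(p, p') * kink d q p p' :=
    mul_nonneg ht.le (Finset.sum_nonneg fun p hp => Finset.sum_nonneg fun p' hp' =>
      hneg p hp p' hp')
  have h3 := hq (q + t • d)
  have h4 := hq (q + (-t) • d)
  have n1 := hq' (q + t • d) (by linarith)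
  have n2 := hq' (q + (-t) • d) (by linarith)
  have hp := parallelogram_law_with_norm ℝ q (t • d)
  rw [neg_smul, ← sub_eq_add_neg] at n2
  have hpos : 0 < ‖t • d‖ := norm_pos_iff.2 (smul_ne_zero ht.ne' hd)
  nlinarith [norm_nonneg (q + t • d), norm_nonneg (q - t • d), norm_nonneg q]

lemma mem_openSegment_of_kink {d q p p' : Pt} (h1 : det2 d (p - q) < 0) (h2 : 0 < det2 d (p' - q))
    (h3 : det2 (p - q) (p' - q) = 0) : q ∈ openSegment ℝ p p' := by
  have hc := det2_cramer d (p - q) (p' - q)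
  rw [h3, zero_smul, add_zero, det2_comm (p' - q)] at hc
  set a := det2 d (p - q)
  set b := det2 d (p' - q)
  have hs : 0 < b - a := by linarith
  refine ⟨b / (b - a), -a / (b - a), by positivity, div_pos (by linarith) hs, ?_, ?_⟩
  · field_simp; ring
  · have h4 : (b - a) • q = b • p - a • p' := by
      have : (b - a) • q = b • p - a • p' + (a • (p' - q) + -b • (p - q)) := by module
      rw [this, hc, add_zero]
    have h5 : q = (b - a)⁻¹ • (b • p - a • p') := by
      rw [← h4, smul_smul, inv_mul_cancel₀ hs.ne', one_smul]
    conv_rhs => rw [h5]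
    rw [div_eq_inv_mul, div_eq_inv_mul]
    module

lemma eq_of_kink {d q p p' : Pt} (h1 : det2 d (p - q) < 0) (h2 : det2 d (p' - q) = 0)
    (h3 : det2 (p - q) (p' - q) = 0) : p' = q := by
  have hc := det2_cramer d (p - q) (p' - q)
  rw [h3, zero_smul, add_zero, det2_comm (p' - q), h2, neg_zero, zero_smul, add_zero] at hc
  exact sub_eq_zero.1 ((smul_eq_zero.1 hc).resolve_left h1.ne)

lemma det2_eq_zero_of_mem_openSegment {p p' q : Pt} (h : q ∈ openSegment ℝ p p') :
    det2 (p' - p) (p - q) = 0 ∧ det2 (p' - p) (p' - q) = 0 := by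
  obtain ⟨a, b, -, -, hab, rfl⟩ := h
  obtain rfl : a = 1 - b := by linarith
  constructor <;> simp [det2] <;> ring

/-- Maximum principle: a stress that is nonnegative off a plane graph which is pointed
at every vertex where the lifting could be positive has nonpositive lifting. -/
lemma height_nonpos {P : Finset Pt} (T : PlaneGraph P) {ω : Sym2 Pt → ℝ} (h : IsStress P ω)
    (hω : ∀ e ∈ pairs P, e ∉ T.edges → 0 ≤ ω e)
    (hP : ∀ q ∈ P, PointedAt T q ∨ height P ω q ≤ 0) (x : Pt) : height P ω x ≤ 0 := by
  by_contra! hx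
  obtain ⟨q, hq0, hq, hq'⟩ := exists_height_max h hx
  have key : ∀ d : Pt, d ≠ 0 → ∃ p p' : Pt, s(p, p') ∈ T.edges ∧ det2 d (p - q) < 0 ∧
      ((p' = q ∧ q ∈ P) ∨ q ∉ P ∧ q ∈ oseg s(p, p')) := by
    intro d hd
    obtain ⟨p, hp, p', hp', hk⟩ := exists_neg_kink_of_max h hd hq hq'
    rw [kink] at hk
    split_ifs at hk with hc
    swap
    · simp at hk
    obtain ⟨h1, h2, h3⟩ := hc
    have hpp : p ≠ p' := by rintro rfl; linarith
    have hT : s(p, p') ∈ T.edges := by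
      by_contra hT
      have := hω _ (mk_mem_pairs.2 ⟨hp, hp', hpp⟩) hT
      nlinarith
    refine ⟨p, p', hT, h1, ?_⟩
    rcases h2.eq_or_lt with h2 | h2
    · have := eq_of_kink h1 h2.symm h3
      subst this
      exact Or.inl ⟨rfl, hp'⟩
    · have hm : q ∈ oseg s(p, p') := mem_openSegment_of_kink h1 h2 h3
      exact Or.inr ⟨fun hqP => T.no_vertex_interior _ hT q hqP hm, hm⟩
  by_cases hqP : q ∈ P
  · rcases hP q hqP with ⟨u, hu⟩ | hle
    swap
    · linarith
    by_cases hu0 : u = 0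
    · obtain ⟨p, p', hT, h1, ⟨rfl, -⟩ | ⟨h2, -⟩⟩ := key _ (coordVec_ne_zero 0)
      · have := hu _ hT (by simp) p (by simp) (by rintro rfl; simp [det2] at h1)
        simp [hu0] at this
      · exact h2 hqP
    · obtain ⟨p, p', hT, h1, ⟨rfl, -⟩ | ⟨h2, -⟩⟩ := key (-perp u)
        (neg_ne_zero.2 (perp_ne_zero hu0))
      · have := hu _ hT (by simp) p (by simp) (by rintro rfl; simp [det2] at h1)
        rw [det2_perp_neg] at h1
        linarith
      · exact h2 hqP
  · obtain ⟨p₀, p₁, hT₀, -, ⟨-, h2⟩ | ⟨-, hm₀⟩⟩ := key _ (coordVec_ne_zero 0)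
    · exact hqP h2
    have hne : p₁ - p₀ ≠ 0 := by
      intro h0
      exact T.not_isDiag _ hT₀ (by simp [(sub_eq_zero.1 h0)])
    obtain ⟨p, p', hT, h1, ⟨-, h2⟩ | ⟨-, hm⟩⟩ := key _ hne
    · exact hqP h2
    have heq : s(p, p') = s(p₀, p₁) := by
      by_contra hne
      have := T.noncrossing _ hT _ hT₀ hne
      exact (Set.mem_empty_iff_false q).1 (this ▸ ⟨hm, hm₀⟩)
    obtain ⟨ha, hb⟩ := det2_eq_zero_of_mem_openSegment hm₀
    rcases Sym2.eq_iff.1 heq with ⟨rfl, rfl⟩ | ⟨rfl, rfl⟩ <;> linarith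

lemma exists_generic_point {P : Finset Pt} (hgen : GeneralPosition P) {p p' : Pt} (hp : p ∈ P)
    (hp' : p' ∈ P) (hpp : p ≠ p') : ∃ s : ℝ, 0 < s ∧ s < 1 ∧ ∀ a ∈ P, ∀ b ∈ P, a ≠ b →
      s(a, b) ≠ s(p, p') →
      det2 (a - (p + s • (p' - p))) (b - (p + s • (p' - p))) ≠ 0 := by
  obtain ⟨s, hs, hs'⟩ := (Set.Ioo_infinite (zero_lt_one' ℝ)).exists_notMem_finset
    ((P ×ˢ P).image fun x => -det2 (x.1 - p) (x.2 - p) /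
      (det2 (x.1 - p') (x.2 - p') - det2 (x.1 - p) (x.2 - p)))
  refine ⟨s, hs.1, hs.2, fun a ha b hb hab hne h0 => ?_⟩
  have h1 : det2 (a - (p + s • (p' - p))) (b - (p + s • (p' - p))) = det2 (a - p) (b - p) +
      s * (det2 (a - p') (b - p') - det2 (a - p) (b - p)) := by
    simp [det2]; ring
  rw [h1] at h0
  by_cases hd : det2 (a - p') (b - p') - det2 (a - p) (b - p) = 0
  · have hz : det2 (a - p) (b - p) = 0 := by rw [hd] at h0; linarith
    have hz' : det2 (a - p') (b - p') = 0 := by linarith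
    have hpm : p = a ∨ p = b := by
      by_contra! hh
      exact det2_ne_zero_of_generalPosition hgen hp ha hb hh.1 hh.2 hab hz
    have hpm' : p' = a ∨ p' = b := by
      by_contra! hh
      exact det2_ne_zero_of_generalPosition hgen hp' ha hb hh.1 hh.2 hab hz'
    rcases hpm with rfl | rfl <;> rcases hpm' with rfl | rfl
    · exact hpp rfl
    · exact hne rfl
    · exact hne Sym2.eq_swap
    · exact hpp rfl
  · refine hs' (Finset.mem_image.2 ⟨(a, b), Finset.mk_mem_product ha hb, ?_⟩)
    rw [div_eq_iff hd]
    linarith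

/-- In general position, a stress is determined by its lifting. -/
lemma eq_zero_of_height_eq_zero {P : Finset Pt} (hgen : GeneralPosition P) {ω : Sym2 Pt → ℝ}
    (h : IsStress P ω) (h0 : ∀ x, height P ω x = 0) : ∀ e ∈ pairs P, ω e = 0 := by
  intro e he
  induction e with | _ p p'
  obtain ⟨hp, hp', hpp⟩ := mk_mem_pairs.1 he
  obtain ⟨s, hs0, hs1, hs⟩ := exists_generic_point hgen hp hp' hpp
  have hw : p' - p ≠ 0 := sub_ne_zero.2 hpp.symm
  have hwpos := inner_self_pos_of_ne hw
  have hd : -perp (p' - p) ≠ 0 := neg_ne_zero.2 (perp_ne_zero hw)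
  obtain ⟨t, ht, h2⟩ := height_second_difference h hd (p + s • (p' - p))
  simp only [h0] at h2
  set q := p + s • (p' - p) with hq
  have e1 : det2 (-perp (p' - p)) (p - q) = -(s * ⟪p' - p, p' - p⟫) := by
    rw [det2_perp_neg, hq, sub_add_cancel_left, inner_neg_right, inner_smul_right]
  have e2 : det2 (-perp (p' - p)) (p' - q) = (1 - s) * ⟪p' - p, p' - p⟫ := by
    have : p' - q = (1 - s) • (p' - p) := by rw [hq]; module
    rw [det2_perp_neg, this, inner_smul_right]
  have e3 : det2 (p - q) (p' - q) = 0 := by simp [hq, det2]; ring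
  have n1 : det2 (-perp (p' - p)) (p - q) < 0 := by rw [e1]; nlinarith
  have n2 : 0 < det2 (-perp (p' - p)) (p' - q) := by rw [e2]; nlinarith
  have hsum : ∑ a ∈ P, ∑ b ∈ P, ω s(a, b) * kink (-perp (p' - p)) q a b
      = ω s(p, p') * kink (-perp (p' - p)) q p p' := by
    have hz : ∀ a ∈ P, ∀ b ∈ P, (a ≠ p ∨ b ≠ p') →
        ω s(a, b) * kink (-perp (p' - p)) q a b = 0 := by
      intro a ha b hb hne
      rw [kink, if_neg, mul_zero]
      rintro ⟨k1, k2, k3⟩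
      have hab : a ≠ b := by rintro rfl; linarith
      refine hs a ha b hb hab (fun heq => ?_) k3
      rcases Sym2.eq_iff.1 heq with ⟨rfl, rfl⟩ | ⟨rfl, rfl⟩
      · simp at hne
      · linarith
    rw [Finset.sum_eq_single_of_mem p hp, Finset.sum_eq_single_of_mem p' hp']
    · exact fun b hb hne => hz p hp b hb (Or.inr hne)
    · exact fun a ha hne => Finset.sum_eq_zero fun b hb => hz a ha b hb (Or.inl hne)
  rw [hsum, kink, if_pos ⟨n1, n2.le, e3⟩] at h2
  have h3 : t * (ω s(p, p') * (det2 (-perp (p' - p)) (p' - q) - det2 (-perp (p' - p)) (p - q)))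
      = 0 := by linarith
  rcases mul_eq_zero.1 h3 with h4 | h4
  · exact absurd h4 ht.ne'
  · exact (mul_eq_zero.1 h4).resolve_right (by linarith)

lemma IsStress.linear {P : Finset Pt} {ω τ : Sym2 Pt → ℝ} (h : IsStress P ω)
    (h' : IsStress P τ) (a b : ℝ) : IsStress P fun e => a * ω e + b * τ e := by
  intro m
  simp only [add_mul, mul_assoc, Finset.sum_add_distrib, ← Finset.mul_sum]
  rw [h m, h' m]; simp

/-- A stress that is nonnegative off one plane graph and nonpositive off another vanishes,
provided the graphs are pointed wherever the lifting has the wrong sign. -/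
theorem IsStress.eq_zero_of_sign {P : Finset Pt} (hgen : GeneralPosition P) (H T : PlaneGraph P)
    {ω : Sym2 Pt → ℝ} (h : IsStress P ω)
    (hT : ∀ e ∈ pairs P, e ∉ T.edges → 0 ≤ ω e) (hH : ∀ e ∈ pairs P, e ∉ H.edges → ω e ≤ 0)
    (hT' : ∀ q ∈ P, PointedAt T q ∨ height P ω q ≤ 0)
    (hH' : ∀ q ∈ P, PointedAt H q ∨ 0 ≤ height P ω q) : ∀ e ∈ pairs P, ω e = 0 := by
  refine eq_zero_of_height_eq_zero hgen h fun x => le_antisymm (height_nonpos T h hT hT' x) ?_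
  have hneg := height_linear P ω ω (-1) 0
  have := height_nonpos H (h.linear h (-1) 0) (fun e he he' => by linarith [hH e he he'])
    (fun q hq => (hH' q hq).imp id fun h0 => by rw [hneg]; linarith) x
  rw [hneg] at this
  linarith

section Polyhedron

variable {ι V : Type*} [AddCommGroup V] [Module ℝ V]

/-- The constraints `f e ≤ r e u` satisfied with equality. -/
noncomputable def tightSet (E : Finset ι) (r : ι → V →ₗ[ℝ] ℝ) (f : ι → ℝ) (u : V) : Finset ι :=
  E.filter fun e => r e u = f e

/-- A set of functionals whose common kernel is that of the whole family. -/
def RigidSet (E : Finset ι) (r : ι → V →ₗ[ℝ] ℝ) (T : Finset ι) : Prop :=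
  ∀ m, (∀ e ∈ T, r e m = 0) → ∀ e ∈ E, r e m = 0

/-- A family of functionals admitting a dual family of vectors. -/
def HasDualVectors (r : ι → V →ₗ[ℝ] ℝ) (T : Finset ι) : Prop :=
  ∀ e ∈ T, ∃ m, r e m = 1 ∧ ∀ e' ∈ T, e' ≠ e → r e' m = 0

lemma mem_tightSet {E : Finset ι} {r : ι → V →ₗ[ℝ] ℝ} {f : ι → ℝ} {u : V} {e : ι} :
    e ∈ tightSet E r f u ↔ e ∈ E ∧ r e u = f e := by
  simp [tightSet]

lemma exists_feasible_hit {E : Finset ι} {r : ι → V →ₗ[ℝ] ℝ} {f : ι → ℝ} {u m : V}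
    (hu : ∀ e ∈ E, f e ≤ r e u) (hm : ∀ e ∈ tightSet E r f u, 0 ≤ r e m)
    (hneg : ∃ e ∈ E, r e m < 0) :
    ∃ t : ℝ, 0 < t ∧ (∀ e ∈ E, f e ≤ r e (u + t • m)) ∧
      ∃ e ∈ tightSet E r f (u + t • m), r e m < 0 := by
  obtain ⟨e₁, he₁, hem₁⟩ := hneg
  obtain ⟨e₀, he₀, hmin⟩ := (E.filter fun e => r e m < 0).exists_min_image
    (fun e => (r e u - f e) / (-r e m)) ⟨e₁, by simp [he₁, hem₁]⟩
  obtain ⟨he₀E, hem₀⟩ := Finset.mem_filter.1 he₀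
  have hs : f e₀ < r e₀ u := by
    refine lt_of_le_of_ne (hu e₀ he₀E) fun h => ?_
    exact hem₀.not_ge (hm e₀ (mem_tightSet.2 ⟨he₀E, h.symm⟩))
  have ht : 0 < (r e₀ u - f e₀) / (-r e₀ m) := div_pos (by linarith) (by linarith)
  refine ⟨_, ht, fun e he => ?_, e₀, mem_tightSet.2 ⟨he₀E, ?_⟩, hem₀⟩
  · simp only [map_add, map_smul, smul_eq_mul]
    rcases le_or_gt 0 (r e m) with h | h
    · have := mul_nonneg ht.le h
      linarith [hu e he]
    · have h1 := hmin e (by simp [he, h])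
      have h2 : 0 < -r e m := by linarith
      have h3 := (le_div_iff₀ h2).1 h1
      linarith
  · simp only [map_add, map_smul, smul_eq_mul]
    field_simp [hem₀.ne]
    ring

/-- From a feasible point one reaches a vertex of the polyhedron without increasing the sum of
some of the constraint functionals. -/
lemma exists_rigid_feasible {E H : Finset ι} (hH : H ⊆ E) {r : ι → V →ₗ[ℝ] ℝ} {f : ι → ℝ} :
    ∀ (n : ℕ) (u : V), (E \ tightSet E r f u).card = n → (∀ e ∈ E, f e ≤ r e u) →
    ∃ u', (∀ e ∈ E, f e ≤ r e u') ∧ RigidSet E r (tightSet E r f u') ∧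
      ∑ h ∈ H, r h u' ≤ ∑ h ∈ H, r h u := by
  intro n
  induction n using Nat.strong_induction_on with | _ n ih
  intro u hn hu
  by_cases hR : RigidSet E r (tightSet E r f u)
  · exact ⟨u, hu, hR, le_rfl⟩
  simp only [RigidSet, not_forall] at hR
  obtain ⟨m₀, hm₀, e₀, he₀, hne⟩ := hR
  obtain ⟨m, hm, hneg, hobj⟩ : ∃ m, (∀ e ∈ tightSet E r f u, r e m = 0) ∧
      (∃ e ∈ E, r e m < 0) ∧ ∑ h ∈ H, r h m ≤ 0 := by
    obtain ⟨m, hm, hne, hobj⟩ : ∃ m, (∀ e ∈ tightSet E r f u, r e m = 0) ∧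
        r e₀ m ≠ 0 ∧ ∑ h ∈ H, r h m ≤ 0 := by
      rcases le_total (∑ h ∈ H, r h m₀) 0 with h | h
      · exact ⟨m₀, hm₀, hne, h⟩
      · exact ⟨-m₀, fun e he => by simp [hm₀ e he], by simpa using hne, by simpa using h⟩
    by_cases hex : ∃ e ∈ E, r e m < 0
    · exact ⟨m, hm, hex, hobj⟩
    push Not at hex
    refine ⟨-m, fun e he => by simp [hm e he], ⟨e₀, he₀, ?_⟩, ?_⟩
    · have := lt_of_le_of_ne (hex e₀ he₀) hne.symm
      simpa using this
    · have := Finset.sum_nonneg fun h hh => hex h (hH hh)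
      simpa using this
  obtain ⟨t, ht, hfeas, e₁, he₁, hem₁⟩ := exists_feasible_hit hu (fun e he => (hm e he).ge) hneg
  have hlt : (E \ tightSet E r f (u + t • m)).card < n := by
    rw [← hn]
    refine Finset.card_lt_card ((Finset.ssubset_iff_of_subset ?_).2 ⟨e₁, ?_, ?_⟩)
    · intro e he
      rw [Finset.mem_sdiff] at he ⊢
      refine ⟨he.1, fun h => he.2 (mem_tightSet.2 ⟨he.1, ?_⟩)⟩
      simp [hm e h, (mem_tightSet.1 h).2]
    · rw [Finset.mem_sdiff]
      exact ⟨(mem_tightSet.1 he₁).1, fun h => hem₁.ne (hm e₁ h)⟩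
    · simp [he₁]
  obtain ⟨u', h1, h2, h3⟩ := ih _ hlt _ rfl hfeas
  refine ⟨u', h1, h2, h3.trans ?_⟩
  simp only [map_add, map_smul, smul_eq_mul, Finset.sum_add_distrib, ← Finset.mul_sum]
  nlinarith

/-- Minimizing a sum of constraint functionals over a nonempty polyhedron. -/
lemma exists_rigid_minimizer {E H : Finset ι} (hH : H ⊆ E) {r : ι → V →ₗ[ℝ] ℝ} {f : ι → ℝ}
    (hne : ∃ u, ∀ e ∈ E, f e ≤ r e u) :
    ∃ u, (∀ e ∈ E, f e ≤ r e u) ∧ RigidSet E r (tightSet E r f u) ∧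
      ∀ u', (∀ e ∈ E, f e ≤ r e u') → ∑ h ∈ H, r h u ≤ ∑ h ∈ H, r h u' := by
  classical
  let R : Set V := {u | (∀ e ∈ E, f e ≤ r e u) ∧ RigidSet E r (tightSet E r f u)}
  obtain ⟨u₀, hu₀⟩ := hne
  obtain ⟨u₁, h1, h2, -⟩ := exists_rigid_feasible hH _ u₀ rfl hu₀
  have hfin : ((fun u => ∑ h ∈ H, r h u) '' R).Finite := by
    have hT : (tightSet E r f '' R).Finite :=
      E.powerset.finite_toSet.subset (by
        rintro _ ⟨u, -, rfl⟩
        exact Finset.mem_coe.2 (Finset.mem_powerset.2 (Finset.filter_subset _ _)))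
    choose! g hg using fun (T : Finset ι) (hT : T ∈ tightSet E r f '' R) => hT
    refine (hT.image fun T => ∑ h ∈ H, r h (g T)).subset ?_
    rintro _ ⟨u, hu, rfl⟩
    refine ⟨_, ⟨u, hu, rfl⟩, ?_⟩
    obtain ⟨-, hgT⟩ := hg _ ⟨u, hu, rfl⟩
    refine Finset.sum_congr rfl fun h hh => ?_
    have hz := hu.2 (g (tightSet E r f u) - u) (fun e he => by
      have h3 : e ∈ tightSet E r f (g (tightSet E r f u)) := by rw [hgT]; exact he
      rw [map_sub, (mem_tightSet.1 h3).2, (mem_tightSet.1 he).2, sub_self]) h (hH hh)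
    rw [map_sub, sub_eq_zero] at hz
    exact hz
  obtain ⟨_, ⟨u, hu, rfl⟩, hmin⟩ := hfin.exists_minimal ⟨_, u₁, ⟨h1, h2⟩, rfl⟩
  refine ⟨u, hu.1, hu.2, fun u' hu' => ?_⟩
  obtain ⟨u'', h1, h2, h3⟩ := exists_rigid_feasible hH _ u' rfl hu'
  rcases le_total (∑ h ∈ H, r h u) (∑ h ∈ H, r h u'') with h | h
  · exact h.trans h3
  · exact (hmin ⟨u'', ⟨h1, h2⟩, rfl⟩ h).trans h3

/-- Optimality certificate at a nondegenerate vertex. -/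
lemma exists_certificate {E H : Finset ι} (hH : H ⊆ E) {r : ι → V →ₗ[ℝ] ℝ} {f : ι → ℝ} {u : V}
    (hu : ∀ e ∈ E, f e ≤ r e u) (hR : RigidSet E r (tightSet E r f u))
    (hD : HasDualVectors r (tightSet E r f u))
    (hmin : ∀ u', (∀ e ∈ E, f e ≤ r e u') → ∑ h ∈ H, r h u ≤ ∑ h ∈ H, r h u') :
    ∃ c : ι → ℝ, (∀ e, 0 ≤ c e) ∧ (∀ e ∉ tightSet E r f u, c e = 0) ∧
      ∀ m, ∑ e ∈ tightSet E r f u, c e * r e m = ∑ h ∈ H, r h m := by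
  classical
  set T := tightSet E r f u with hT
  choose! b hb1 hb0 using hD
  have hpos : ∀ e ∈ T, 0 ≤ ∑ h ∈ H, r h (b e) := by
    intro e he
    by_contra! hlt
    have hTn : ∀ e' ∈ T, 0 ≤ r e' (b e) := by
      intro e' he'
      by_cases h : e' = e
      · subst h; rw [hb1 e' he']; exact zero_le_one
      · rw [hb0 e he e' he' h]
    obtain ⟨t, ht, hfeas⟩ : ∃ t : ℝ, 0 < t ∧ ∀ e' ∈ E, f e' ≤ r e' (u + t • b e) := by
      by_cases hneg : ∃ e' ∈ E, r e' (b e) < 0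
      · obtain ⟨t, ht, hfeas, -⟩ := exists_feasible_hit hu hTn hneg
        exact ⟨t, ht, hfeas⟩
      · push Not at hneg
        refine ⟨1, one_pos, fun e' he' => ?_⟩
        have := hneg e' he'
        simp only [one_smul, map_add]
        linarith [hu e' he']
    have := hmin _ hfeas
    simp only [map_add, map_smul, smul_eq_mul, Finset.sum_add_distrib, ← Finset.mul_sum] at this
    nlinarith
  refine ⟨fun e => if e ∈ T then ∑ h ∈ H, r h (b e) else 0, fun e => ?_, fun e he => if_neg he,
    fun m => ?_⟩
  · dsimp only
    split_ifs with h
    · exact hpos e h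
    · exact le_rfl
  · have hz : ∀ h ∈ H, r h m = ∑ e ∈ T, r e m * r h (b e) := by
      intro h hh
      have := hR (m - ∑ e ∈ T, r e m • b e) (fun e' he' => by
        rw [map_sub, map_sum, Finset.sum_eq_single_of_mem e' he', map_smul, hb1 e' he']
        · simp
        · intro e he hne
          rw [map_smul, hb0 e he e' he' hne.symm, smul_zero]) h (hH hh)
      rw [map_sub, map_sum, sub_eq_zero] at this
      simpa using this
    rw [Finset.sum_congr rfl hz, Finset.sum_comm]
    refine Finset.sum_congr rfl fun e he => ?_
    dsimp only
    rw [if_pos he, Finset.sum_mul]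
    exact Finset.sum_congr rfl fun h _ => mul_comm _ _

/-- A rigid family is at least as large as any family with dual vectors. -/
lemma card_le_of_rigidSet {E G H : Finset ι} (hH : H ⊆ E) {r : ι → V →ₗ[ℝ] ℝ}
    (hG : RigidSet E r G) (hD : HasDualVectors r H) : H.card ≤ G.card := by
  classical
  choose! b hb1 hb0 using hD
  have hli : LinearIndependent ℝ fun (h : H) (g : G) => r g (b h) := by
    rw [Fintype.linearIndependent_iff]
    intro c hc h
    have h1 : ∀ e ∈ G, r e (∑ h : H, c h • b h) = 0 := by
      intro e he
      have := congrFun hc ⟨e, he⟩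
      simpa [map_sum] using this
    have h2 := hG _ h1 h (hH h.2)
    rw [map_sum, Finset.sum_eq_single h] at h2
    · simpa [hb1 h h.2] using h2
    · intro h' _ hne
      rw [map_smul, hb0 h' h'.2 h h.2 (fun hh => hne (Subtype.ext hh.symm)), smul_zero]
    · simp
  simpa using hli.fintype_card_le_finrank

/-- A functional is a combination of any rigid family with dual vectors. -/
lemma exists_combination_of_rigidSet {E G : Finset ι} {r : ι → V →ₗ[ℝ] ℝ}
    (hG : RigidSet E r G) (hD : HasDualVectors r G) {e : ι} (he : e ∈ E) :
    ∃ c : ι → ℝ, ∀ m, ∑ g ∈ G, c g * r g m = r e m := by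
  classical
  choose! b hb1 hb0 using hD
  refine ⟨fun g => r e (b g), fun m => ?_⟩
  have := hG (m - ∑ e ∈ G, r e m • b e) (fun e' he' => by
    rw [map_sub, map_sum, Finset.sum_eq_single_of_mem e' he', map_smul, hb1 e' he']
    · simp
    · intro e he hne
      rw [map_smul, hb0 e he e' he' hne.symm, smul_zero]) e he
  rw [map_sub, map_sum, sub_eq_zero] at this
  rw [this]
  exact Finset.sum_congr rfl fun g _ => by rw [map_smul, smul_eq_mul, mul_comm]

end Polyhedron

/-- The right-hand sides of the expansion inequalities. -/
noncomputable def load (e : Sym2 Pt) : ℝ :=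
  Sym2.lift ⟨fun p q => det2 p q ^ 2, fun p q => by
    dsimp only; rw [det2_comm, neg_sq]⟩ e

lemma load_mk (p q : Pt) : load s(p, q) = det2 p q ^ 2 := rfl

/-- The polyhedron of expansive motions with perturbed right-hand sides. -/
def Feasible (P : Finset Pt) (u : Pt → Pt) : Prop := ∀ e ∈ pairs P, load e ≤ stretch e u

lemma Feasible.le {P : Finset Pt} {u : Pt → Pt} (hu : Feasible P u) {p q : Pt} (hp : p ∈ P)
    (hq : q ∈ P) : det2 p q ^ 2 ≤ ⟪p - q, u p - u q⟫ := by
  by_cases h : p = q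
  · subst h; simp
  · exact hu _ (mk_mem_pairs.2 ⟨hp, hq, h⟩)

lemma exists_feasible (P : Finset Pt) : ∃ u, Feasible P u := by
  have hpos : ∀ e ∈ pairs P, 0 < stretch e id := by
    intro e he
    induction e with | _ p q
    rw [stretch_mk]
    exact inner_self_pos_of_ne (sub_ne_zero.2 (mk_mem_pairs.1 he).2.2)
  obtain ⟨t, ht⟩ := ((pairs P).image fun e => load e / stretch e id).bddAbove
  refine ⟨t • id, fun e he => ?_⟩
  rw [map_smul, smul_eq_mul, ← div_le_iff₀ (hpos e he)]
  exact ht (Finset.mem_coe.2 (Finset.mem_image_of_mem _ he))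

lemma sum_slack_crossing (x d d' u u₁ u' u₁' : Pt) (s t : ℝ)
    (h : ⟪(x - s • d) - (x + (1 - s) • d), u - u₁⟫ = det2 (x - s • d) (x + (1 - s) • d) ^ 2)
    (h' : ⟪(x - t • d') - (x + (1 - t) • d'), u' - u₁'⟫
      = det2 (x - t • d') (x + (1 - t) • d') ^ 2) :
    (1 - s) * (1 - t) * (⟪(x - s • d) - (x - t • d'), u - u'⟫
        - det2 (x - s • d) (x - t • d') ^ 2)
      + (1 - s) * t * (⟪(x - s • d) - (x + (1 - t) • d'), u - u₁'⟫
        - det2 (x - s • d) (x + (1 - t) • d') ^ 2)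
      + s * (1 - t) * (⟪(x + (1 - s) • d) - (x - t • d'), u₁ - u'⟫
        - det2 (x + (1 - s) • d) (x - t • d') ^ 2)
      + s * t * (⟪(x + (1 - s) • d) - (x + (1 - t) • d'), u₁ - u₁'⟫
        - det2 (x + (1 - s) • d) (x + (1 - t) • d') ^ 2)
      = -(s * (1 - s) * (t * (1 - t)) * det2 d d' ^ 2) := by
  simp only [inner_eq_coord, det2, PiLp.sub_apply, PiLp.add_apply, PiLp.smul_apply,
    smul_eq_mul] at *
  linear_combination s * (1 - s) * h + t * (1 - t) * h'

lemma tightSet_noncrossing {P : Finset Pt} (hgen : GeneralPosition P) {u : Pt → Pt}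
    (hu : Feasible P u) {e f : Sym2 Pt} (he : e ∈ tightSet (pairs P) stretch load u)
    (hf : f ∈ tightSet (pairs P) stretch load u) (hef : e ≠ f) : oseg e ∩ oseg f = ∅ := by
  rw [Set.eq_empty_iff_forall_notMem]
  rintro x ⟨hxe, hxf⟩
  induction e with | _ p q
  induction f with | _ p' q'
  obtain ⟨he1, he2⟩ := mem_tightSet.1 he
  obtain ⟨hf1, hf2⟩ := mem_tightSet.1 hf
  obtain ⟨hp, hq, hpq⟩ := mk_mem_pairs.1 he1
  obtain ⟨hp', hq', hpq'⟩ := mk_mem_pairs.1 hf1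
  obtain ⟨a, s, ha, hs, has, hx⟩ := hxe
  obtain ⟨b, t, hb, ht, hbt, hx'⟩ := hxf
  obtain rfl : a = 1 - s := by linarith
  obtain rfl : b = 1 - t := by linarith
  obtain ⟨d, hd⟩ : ∃ d, d = q - p := ⟨_, rfl⟩
  obtain ⟨d', hd'⟩ : ∃ d', d' = q' - p' := ⟨_, rfl⟩
  have e1 : p = x - s • d := by rw [← hx, hd]; module
  have e2 : q = x + (1 - s) • d := by rw [← hx, hd]; module
  have e3 : p' = x - t • d' := by rw [← hx', hd']; module
  have e4 : q' = x + (1 - t) • d' := by rw [← hx', hd']; module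
  by_cases h0 : det2 d d' = 0
  · have h1 : det2 (q - p) (p' - p) = 0 := by
      rw [← hd, e3, e1]; simp [det2] at h0 ⊢; linear_combination (-t) * h0
    have h2 : det2 (q - p) (q' - p) = 0 := by
      rw [← hd, e4, e1]; simp [det2] at h0 ⊢; linear_combination (1 - t) * h0
    have h3 : p' = p ∨ p' = q := by
      by_contra! h
      exact det2_ne_zero_of_generalPosition hgen hp hq hp' hpq h.1.symm h.2.symm h1
    have h4 : q' = p ∨ q' = q := by
      by_contra! h
      exact det2_ne_zero_of_generalPosition hgen hp hq hq' hpq h.1.symm h.2.symm h2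
    rcases h3 with rfl | rfl <;> rcases h4 with rfl | rfl
    · exact hpq' rfl
    · exact hef rfl
    · exact hef Sym2.eq_swap
    · exact hpq' rfl
  · have key := sum_slack_crossing x d d' (u p) (u q) (u p') (u q') s t
      (by rw [← e1, ← e2]; exact he2) (by rw [← e3, ← e4]; exact hf2)
    rw [← e1, ← e2, ← e3, ← e4] at key
    have k1 := mul_nonneg (mul_pos ha hb).le (sub_nonneg.2 (hu.le hp hp'))
    have k2 := mul_nonneg (mul_pos ha ht).le (sub_nonneg.2 (hu.le hp hq'))
    have k3 := mul_nonneg (mul_pos hs hb).le (sub_nonneg.2 (hu.le hq hp'))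
    have k4 := mul_nonneg (mul_pos hs ht).le (sub_nonneg.2 (hu.le hq hq'))
    have k5 : 0 < s * (1 - s) * (t * (1 - t)) * det2 d d' ^ 2 := by positivity
    linarith

lemma notMem_openSegment_of_generalPosition {P : Finset Pt} (hgen : GeneralPosition P)
    {p q r : Pt} (hp : p ∈ P) (hq : q ∈ P) (hr : r ∈ P) (hpq : p ≠ q) :
    r ∉ openSegment ℝ p q := by
  rintro ⟨a, s, ha, hs, has, hx⟩
  obtain rfl : a = 1 - s := by linarith
  have e1 : r - p = s • (q - p) := by rw [← hx]; module
  have e2 : r - q = (1 - s) • (p - q) := by rw [← hx]; module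
  have n1 : p ≠ r := by
    rintro rfl
    rw [sub_self] at e1
    exact hpq (sub_eq_zero.1 ((smul_eq_zero.1 e1.symm).resolve_left hs.ne')).symm
  have n2 : q ≠ r := by
    rintro rfl
    rw [sub_self] at e2
    exact hpq (sub_eq_zero.1 ((smul_eq_zero.1 e2.symm).resolve_left ha.ne'))
  refine det2_ne_zero_of_generalPosition hgen hp hq hr hpq n1 n2 ?_
  rw [e1]
  simp [det2]; ring

/-- A finite set of vectors not contained in an open half-plane is positively dependent. -/
lemma exists_weights_of_not_halfPlane {A : Finset Pt} (hA : ¬ ∃ u : Pt, ∀ a ∈ A, 0 < ⟪u, a⟫) :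
    ∃ w : Pt → ℝ, (∀ a ∈ A, 0 ≤ w a) ∧ ∑ a ∈ A, w a = 1 ∧ ∑ a ∈ A, w a • a = 0 := by
  have h0 : (0 : Pt) ∈ convexHull ℝ (A : Set Pt) := by
    by_contra h0
    obtain ⟨f, c, hf0, hf⟩ := geometric_hahn_banach_point_closed (convex_convexHull ℝ (A : Set Pt))
      (A.finite_toSet.isClosed_convexHull ℝ) h0
    refine hA ⟨(InnerProductSpace.toDual ℝ Pt).symm f, fun a ha => ?_⟩
    rw [InnerProductSpace.toDual_symm_apply]
    have := hf a (subset_convexHull ℝ _ (Finset.mem_coe.2 ha))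
    rw [map_zero] at hf0
    linarith
  obtain ⟨w, h1, h2, h3⟩ := Finset.mem_convexHull'.1 h0
  exact ⟨w, h1, h2, h3⟩

lemma sum_slack_star (A : Finset Pt) (w : Pt → ℝ) (hw : ∑ a ∈ A, w a • a = 0) (v : Pt)
    (W : Pt → Pt) (hW : ∀ a ∈ A, ⟪a, W a⟫ = det2 v a ^ 2) :
    ∑ a ∈ A, ∑ b ∈ A, w a * w b * (⟪a - b, W a - W b⟫ - det2 (v + a) (v + b) ^ 2)
      = -∑ a ∈ A, ∑ b ∈ A, w a * w b * det2 a b ^ 2 := by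
  have hlin : ∀ c : Pt, ∑ a ∈ A, w a * (c 0 * a 0 + c 1 * a 1) = 0 := by
    intro c
    have : ⟪c, ∑ a ∈ A, w a • a⟫ = 0 := by rw [hw, inner_zero_right]
    simpa only [inner_sum, inner_smul_right, inner_eq_coord] using this
  obtain ⟨X, hX⟩ : ∃ X : Pt → Pt → ℝ, X = fun a b =>
    w a * w b * (⟪b, W a⟫ - det2 v a * det2 v b - 2 * det2 a b * det2 v a) := ⟨_, rfl⟩
  have h1 : ∑ a ∈ A, ∑ b ∈ A, X a b = 0 := by
    refine Finset.sum_eq_zero fun a _ => ?_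
    have := congrArg (w a * ·) (hlin !₂[W a 0 + det2 v a * (v 1 + 2 * a 1),
      W a 1 - det2 v a * (v 0 + 2 * a 0)])
    simp only [Finset.mul_sum, mul_zero] at this
    rw [← this]
    refine Finset.sum_congr rfl fun b _ => ?_
    simp only [hX, inner_eq_coord, det2]
    simp
    ring
  have h2 : ∑ a ∈ A, ∑ b ∈ A, X b a = 0 := by rw [Finset.sum_comm, h1]
  have h3 : ∀ a ∈ A, ∀ b ∈ A, w a * w b * (⟪a - b, W a - W b⟫ - det2 (v + a) (v + b) ^ 2)
      = -(w a * w b * det2 a b ^ 2) - X a b - X b a := by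
    intro a ha b hb
    have ka := hW a ha
    have kb := hW b hb
    simp only [hX, inner_eq_coord, det2, PiLp.sub_apply, PiLp.add_apply] at *
    linear_combination w a * w b * (ka + kb)
  rw [Finset.sum_congr rfl fun a ha => Finset.sum_congr rfl fun b hb => h3 a ha b hb]
  simp only [Finset.sum_sub_distrib, Finset.sum_neg_distrib, h1, h2]
  ring

lemma tightSet_pointed {P : Finset Pt} (hgen : GeneralPosition P) {u : Pt → Pt}
    (hu : Feasible P u) {v : Pt} (hv : v ∈ P) :
    ∃ x : Pt, ∀ e ∈ tightSet (pairs P) stretch load u, v ∈ e → ∀ w ∈ e, w ≠ v →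
      0 < ⟪x, w - v⟫ := by
  set T := tightSet (pairs P) stretch load u with hT
  set A : Finset Pt := (P.filter fun w => s(v, w) ∈ T).image fun w => w - v with hA
  have hmem : ∀ a ∈ A, v + a ∈ P ∧ s(v, v + a) ∈ T := by
    intro a ha
    obtain ⟨w, hw, rfl⟩ := Finset.mem_image.1 ha
    simpa using hw
  by_contra hne
  have hhp : ¬ ∃ x : Pt, ∀ a ∈ A, 0 < ⟪x, a⟫ := by
    rintro ⟨x, hx⟩
    refine hne ⟨x, fun e he hve w hwe hwv => hx _ (Finset.mem_image.2 ⟨w, ?_, rfl⟩)⟩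
    have hes : e = s(v, w) := (Sym2.mem_and_mem_iff hwv.symm).1 ⟨hve, hwe⟩
    subst hes
    exact Finset.mem_filter.2 ⟨(mk_mem_pairs.1 (mem_tightSet.1 he).1).2.1, he⟩
  obtain ⟨w, hw0, hw1, hw⟩ := exists_weights_of_not_halfPlane hhp
  have ha0 : ∀ a ∈ A, a ≠ 0 := by
    intro a ha h0
    have := (mk_mem_pairs.1 (mem_tightSet.1 (hmem a ha).2).1).2.2
    simp [h0] at this
  have key := sum_slack_star A w hw v (fun a => u (v + a) - u v) (fun a ha => by
    have h1 := (mem_tightSet.1 (hmem a ha).2).2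
    rw [stretch_mk, load_mk] at h1
    have h2 : det2 v (v + a) = det2 v a := by simp [det2]; ring
    rw [h2] at h1
    rw [← h1, ← inner_neg_neg]
    congr 1 <;> abel)
  have hpos : ∀ a ∈ A, ∀ b ∈ A, 0 ≤ w a * w b *
      (⟪a - b, u (v + a) - u v - (u (v + b) - u v)⟫ - det2 (v + a) (v + b) ^ 2) := by
    intro a ha b hb
    refine mul_nonneg (mul_nonneg (hw0 a ha) (hw0 b hb)) (sub_nonneg.2 ?_)
    have := hu.le (hmem a ha).1 (hmem b hb).1
    rwa [add_sub_add_left_eq_sub, ← sub_sub_sub_cancel_right (u (v + a)) _ (u v)] at this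
  have hD : ∀ a ∈ A, ∀ b ∈ A, w a * w b * det2 a b ^ 2 = 0 := by
    have hnn : ∀ a ∈ A, ∀ b ∈ A, 0 ≤ w a * w b * det2 a b ^ 2 := fun a ha b hb =>
      mul_nonneg (mul_nonneg (hw0 a ha) (hw0 b hb)) (sq_nonneg _)
    have hs : ∑ a ∈ A, ∑ b ∈ A, w a * w b * det2 a b ^ 2 = 0 := by
      refine le_antisymm ?_ (Finset.sum_nonneg fun a ha => Finset.sum_nonneg (hnn a ha))
      have := Finset.sum_nonneg fun a ha => Finset.sum_nonneg (hpos a ha)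
      linarith
    intro a ha b hb
    have := (Finset.sum_eq_zero_iff_of_nonneg
      (fun a ha => Finset.sum_nonneg (hnn a ha))).1 hs a ha
    exact (Finset.sum_eq_zero_iff_of_nonneg (hnn a ha)).1 this b hb
  obtain ⟨a, ha, hwa⟩ : ∃ a ∈ A, 0 < w a := by
    by_contra! h
    have := Finset.sum_nonpos h
    linarith
  have hb : ∀ b ∈ A, b ≠ a → w b = 0 := by
    intro b hb hba
    have h1 := hD a ha b hb
    have h2 := det2_ne_zero_of_generalPosition hgen hv (hmem a ha).1 (hmem b hb).1
      (by simpa using ha0 a ha) (by simpa using ha0 b hb) (by simpa using hba.symm)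
    simp only [add_sub_cancel_left] at h2
    have h3 : det2 a b ^ 2 ≠ 0 := pow_ne_zero 2 h2
    have := (mul_eq_zero.1 h1).resolve_right h3
    exact (mul_eq_zero.1 this).resolve_left hwa.ne'
  rw [Finset.sum_eq_single_of_mem a ha (fun b hb' hne => by rw [hb b hb' hne, zero_smul])] at hw
  exact ha0 a ha ((smul_eq_zero.1 hw).resolve_left hwa.ne')

/-- The tight constraints at a feasible point form a plane graph. -/
noncomputable def tightGraph {P : Finset Pt} (hgen : GeneralPosition P) {u : Pt → Pt}
    (hu : Feasible P u) : PlaneGraph P where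
  edges := tightSet (pairs P) stretch load u
  not_isDiag e he := (Finset.mem_filter.1 (mem_tightSet.1 he).1).2
  endpoints_mem e he p hp :=
    Finset.mem_sym2_iff.1 (Finset.mem_filter.1 (mem_tightSet.1 he).1).1 p hp
  noncrossing e he f hf hef := tightSet_noncrossing hgen hu he hf hef
  no_vertex_interior e he r hr := by
    induction e with | _ p q
    obtain ⟨hp, hq, hpq⟩ := mk_mem_pairs.1 (mem_tightSet.1 he).1
    exact notMem_openSegment_of_generalPosition hgen hp hq hr hpq

lemma tightGraph_pointed {P : Finset Pt} (hgen : GeneralPosition P) {u : Pt → Pt}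
    (hu : Feasible P u) : PointedGraph (tightGraph hgen hu) := fun _ hv =>
  tightSet_pointed hgen hu hv

lemma PlaneGraph.edges_subset_pairs {P : Finset Pt} (G : PlaneGraph P) : G.edges ⊆ pairs P := by
  intro e he
  exact Finset.mem_filter.2 ⟨Finset.mem_sym2_iff.2 (G.endpoints_mem e he), G.not_isDiag e he⟩

/-- The edges of a pointed plane graph impose independent conditions. -/
lemma PointedGraph.hasDualVectors {P : Finset Pt} (hgen : GeneralPosition P) {G : PlaneGraph P}
    (hG : PointedGraph G) : HasDualVectors stretch G.edges := by
  intro e he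
  by_contra! hne
  have hker : (⨅ i : (G.edges.erase e : Finset (Sym2 Pt)), LinearMap.ker (stretch i))
      ≤ LinearMap.ker (stretch e) := by
    intro m hm
    rw [LinearMap.mem_ker]
    by_contra h
    have hz : ∀ e' ∈ G.edges, e' ≠ e → stretch e' m = 0 := by
      intro e' he' hee'
      exact LinearMap.mem_ker.1 ((Submodule.mem_iInf _).1 hm
        ⟨e', Finset.mem_erase.2 ⟨hee', he'⟩⟩)
    obtain ⟨e', he', hee', h'⟩ := hne ((stretch e m)⁻¹ • m)
      (by rw [map_smul, smul_eq_mul, inv_mul_cancel₀ h])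
    exact h' (by rw [map_smul, hz e' he' hee', smul_zero])
  obtain ⟨c, hc⟩ := (Submodule.mem_span_range_iff_exists_fun ℝ).1 (mem_span_of_iInf_ker_le_ker hker)
  let ω : Sym2 Pt → ℝ := fun e' =>
    if h : e' ∈ G.edges.erase e then c ⟨e', h⟩ else if e' = e then -1 else 0
  have hω : ∀ e' ∉ G.edges, ω e' = 0 := by
    intro e' he'
    have h1 : e' ∉ G.edges.erase e := fun h => he' (Finset.mem_of_mem_erase h)
    have h2 : e' ≠ e := by rintro rfl; exact he' he
    simp only [ω, dif_neg h1, if_neg h2]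
  have hst : IsStress P ω := by
    intro m
    rw [← Finset.sum_subset G.edges_subset_pairs
      (fun e' _ he' => by rw [hω e' he', zero_mul]), ← Finset.add_sum_erase _ _ he]
    have h1 : ω e = -1 := by simp [ω]
    have h2 : ∑ x ∈ G.edges.erase e, ω x * stretch x m = stretch e m := by
      rw [← hc, LinearMap.sum_apply, ← Finset.sum_coe_sort]
      refine Finset.sum_congr rfl fun i _ => ?_
      simp only [ω, dif_pos i.2]
      rfl
    rw [h1, h2]; ring
  have := hst.eq_zero_of_sign hgen G G (fun e' _ h => (hω e' h).ge) (fun e' _ h => (hω e' h).le)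
    (fun q hq => Or.inl (hG q hq)) (fun q hq => Or.inl (hG q hq)) e (G.edges_subset_pairs he)
  simp [ω] at this

/-- A stress written as an explicit combination of edges of two graphs. -/
lemma isStress_of_combination {P : Finset Pt} {A B : Finset (Sym2 Pt)} (hA : A ⊆ pairs P)
    (hB : B ⊆ pairs P) {a b : Sym2 Pt → ℝ}
    (h : ∀ m, ∑ e ∈ A, a e * stretch e m = ∑ e ∈ B, b e * stretch e m) :
    IsStress P fun e => (if e ∈ A then a e else 0) - (if e ∈ B then b e else 0) := by
  intro m
  simp only [sub_mul, Finset.sum_sub_distrib, ite_mul, zero_mul, Finset.sum_ite_mem]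
  rw [Finset.inter_eq_right.2 hA, Finset.inter_eq_right.2 hB, h m, sub_self]

/-- Every pointed plane graph is part of a rigid pointed tight graph. -/
lemma PointedGraph.exists_rigid_feasible {P : Finset Pt} (hgen : GeneralPosition P)
    {G : PlaneGraph P} (hG : PointedGraph G) : ∃ u, ∃ hu : Feasible P u,
      G.edges ⊆ (tightGraph hgen hu).edges ∧
      RigidSet (pairs P) stretch (tightGraph hgen hu).edges := by
  obtain ⟨u, hu, hR, hmin⟩ := exists_rigid_minimizer G.edges_subset_pairs (exists_feasible P)
  have hu' : Feasible P u := hu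
  refine ⟨u, hu', ?_, hR⟩
  have hT := tightGraph_pointed hgen hu'
  obtain ⟨c, hc0, hcT, hc⟩ := exists_certificate G.edges_subset_pairs hu hR
    (hT.hasDualVectors hgen) hmin
  have hst := isStress_of_combination (P := P) (a := fun _ => 1) (b := c) G.edges_subset_pairs
    (tightGraph hgen hu').edges_subset_pairs (fun m => by
      simp only [one_mul]; exact (hc m).symm)
  have hz := hst.eq_zero_of_sign hgen G (tightGraph hgen hu')
    (fun e _ h => by
      rw [if_neg h]
      split_ifs <;> norm_num)
    (fun e _ h => by
      rw [if_neg h]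
      split_ifs <;> simp [hc0 e])
    (fun q hq => Or.inl (hT q hq)) (fun q hq => Or.inl (hG q hq))
  intro e he
  have := hz e (G.edges_subset_pairs he)
  by_contra h
  rw [if_pos he, if_neg h] at this
  norm_num at this

lemma IsPointedPseudoTriangulation.exists_feasible {P : Finset Pt} (hgen : GeneralPosition P)
    {G : PlaneGraph P} (hG : IsPointedPseudoTriangulation G) : ∃ u, Feasible P u ∧
      tightSet (pairs P) stretch load u = G.edges ∧ RigidSet (pairs P) stretch G.edges := by
  obtain ⟨u, hu, hsub, hR⟩ := hG.1.exists_rigid_feasible hgen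
  have := hG.2 _ (tightGraph_pointed hgen hu) hsub
  refine ⟨u, hu, this, ?_⟩
  rwa [this] at hR

/-- Flipping an edge whose removal leaves a motion that is not expansive. -/
lemma exists_flip_of_not_expansive {P : Finset Pt} (hgen : GeneralPosition P)
    {G : PlaneGraph P} (hG : IsPointedPseudoTriangulation G) {e : Sym2 Pt} (he : e ∈ G.edges)
    {m : Pt → Pt} (hm1 : stretch e m = 1) (hm0 : ∀ e' ∈ G.edges, e' ≠ e → stretch e' m = 0)
    (hneg : ∃ e' ∈ pairs P, stretch e' m < 0) :
    ∃ (G' : PlaneGraph P) (e' : Sym2 Pt), PPTFlip G G' e e' := by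
  obtain ⟨u, hu, hT, hR⟩ := hG.exists_feasible hgen
  have hmT : ∀ e' ∈ tightSet (pairs P) stretch load u, 0 ≤ stretch e' m := by
    rw [hT]
    intro e' he'
    by_cases h : e' = e
    · rw [h, hm1]; exact zero_le_one
    · rw [hm0 e' he' h]
  obtain ⟨t, ht, hfeas, e', he', hem'⟩ := exists_feasible_hit hu hmT hneg
  set H := tightGraph hgen (u := u + t • m) hfeas with hH
  have hHp : PointedGraph H := tightGraph_pointed hgen hfeas
  have he'G : e' ∉ G.edges := fun h => hem'.not_ge (hmT e' (by rwa [hT]))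
  have hsub : insert e' (G.edges.erase e) ⊆ H.edges := by
    intro f hf
    rcases Finset.mem_insert.1 hf with rfl | hf
    · exact he'
    · obtain ⟨hfe, hfG⟩ := Finset.mem_erase.1 hf
      have h1 := (mem_tightSet.1 (hT ▸ hfG))
      refine mem_tightSet.2 ⟨h1.1, ?_⟩
      rw [map_add, map_smul, hm0 f hfG hfe, smul_zero, add_zero, h1.2]
  have hcard : (insert e' (G.edges.erase e)).card = G.edges.card := by
    rw [Finset.card_insert_of_notMem fun h => he'G (Finset.mem_of_mem_erase h),
      Finset.card_erase_add_one he]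
  have hle : ∀ H' : PlaneGraph P, PointedGraph H' → H'.edges.card ≤ G.edges.card :=
    fun H' h' => card_le_of_rigidSet H'.edges_subset_pairs hR (h'.hasDualVectors hgen)
  have hHe : H.edges = insert e' (G.edges.erase e) :=
    (Finset.eq_of_subset_of_card_le hsub (by rw [hcard]; exact hle H hHp)).symm
  refine ⟨H, e', hG, ⟨hHp, fun H' h' hs => ?_⟩, he, he'G, hHe⟩
  refine (Finset.eq_of_subset_of_card_le hs ?_).symm
  rw [hHe, hcard]
  exact hle H' h'

/-- `x` is a vertex of the convex hull of `P`, exposed by a half-plane. -/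
def Extreme (P : Finset Pt) (x : Pt) : Prop :=
  x ∈ P ∧ ∃ u : Pt, ∀ w ∈ P, w ≠ x → 0 < ⟪u, w - x⟫

/-- The segment from `x` to `y` is a counterclockwise hull edge of `P`. -/
def HullEdge (P : Finset Pt) (x y : Pt) : Prop :=
  x ∈ P ∧ y ∈ P ∧ x ≠ y ∧ ∀ z ∈ P, z ≠ x → z ≠ y → 0 < det2 (y - x) (z - x)

lemma det2_mul_inner_self (u a b : Pt) :
    det2 a b * ⟪u, u⟫ = ⟪u, a⟫ * det2 u b - ⟪u, b⟫ * det2 u a := by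
  simp only [inner_eq_coord, det2]; ring

lemma det2_eq_div_sub_div {u a b : Pt} (ha : 0 < ⟪u, a⟫) (hb : 0 < ⟪u, b⟫) :
    det2 a b * ⟪u, u⟫ = ⟪u, a⟫ * ⟪u, b⟫ * (det2 u b / ⟪u, b⟫ - det2 u a / ⟪u, a⟫) := by
  rw [det2_mul_inner_self]
  field_simp

/-- Vectors in an open half-plane have a first and a last one in counterclockwise order. -/
lemma exists_first_last {W : Finset Pt} (hW : W.Nonempty) {u : Pt}
    (hu : ∀ w ∈ W, 0 < ⟪u, w⟫) (hne : ∀ a ∈ W, ∀ b ∈ W, a ≠ b → det2 a b ≠ 0) :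
    (∃ a ∈ W, ∀ b ∈ W, b ≠ a → 0 < det2 a b) ∧ ∃ c ∈ W, ∀ b ∈ W, b ≠ c → 0 < det2 b c := by
  have key : ∀ a ∈ W, ∀ b ∈ W, b ≠ a → det2 u a / ⟪u, a⟫ ≤ det2 u b / ⟪u, b⟫ →
      0 < det2 a b := by
    intro a ha b hb hba hle
    have h1 := det2_eq_div_sub_div (hu a ha) (hu b hb)
    have h2 : 0 ≤ det2 a b * ⟪u, u⟫ := by
      rw [h1]
      exact mul_nonneg (mul_pos (hu a ha) (hu b hb)).le (sub_nonneg.2 hle)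
    have h3 : 0 < ⟪u, u⟫ := by
      refine inner_self_pos_of_ne ?_
      rintro rfl
      have := hu a ha
      simp at this
    exact lt_of_le_of_ne (nonneg_of_mul_nonneg_left h2 h3) (hne a ha b hb hba.symm).symm
  obtain ⟨a, ha, hmin⟩ := W.exists_min_image (fun w => det2 u w / ⟪u, w⟫) hW
  obtain ⟨c, hc, hmax⟩ := W.exists_max_image (fun w => det2 u w / ⟪u, w⟫) hW
  exact ⟨⟨a, ha, fun b hb hba => key a ha b hb hba (hmin b hb)⟩,
    ⟨c, hc, fun b hb hbc => key b hb c hc hbc.symm (hmax b hb)⟩⟩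

/-- A closed half-plane whose boundary meets the vectors along one ray may be tilted. -/
lemma exists_tilted_halfPlane (W : Finset Pt) (n y : Pt)
    (h : ∀ w ∈ W, 0 < ⟪n, w⟫ ∨ ⟪n, w⟫ = 0 ∧ 0 < ⟪y, w⟫) : ∃ u : Pt, ∀ w ∈ W, 0 < ⟪u, w⟫ := by
  have key : ∀ᶠ t : ℝ in 𝓝[>] 0, ∀ w ∈ W, 0 < ⟪n, w⟫ + t * ⟪y, w⟫ := by
    refine (Finset.eventually_all W).2 fun w hw => ?_
    rcases h w hw with h1 | ⟨h1, h2⟩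
    · have hc : Tendsto (fun t : ℝ => ⟪n, w⟫ + t * ⟪y, w⟫) (𝓝 0) (𝓝 (⟪n, w⟫ + 0 * ⟪y, w⟫)) :=
        (Continuous.tendsto (by fun_prop) 0)
      rw [zero_mul, add_zero] at hc
      exact (hc.mono_left nhdsWithin_le_nhds).eventually_const_lt h1
    · filter_upwards [self_mem_nhdsWithin] with t ht
      rw [h1, zero_add]
      exact mul_pos ht h2
  obtain ⟨t, ht⟩ := key.exists
  refine ⟨n + t • y, fun w hw => ?_⟩
  rw [inner_add_left, real_inner_smul_left]
  exact ht w hw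

lemma HullEdge.extreme {P : Finset Pt} {x y : Pt} (h : HullEdge P x y) :
    Extreme P x ∧ Extreme P y := by
  obtain ⟨hx, hy, hxy, hz⟩ := h
  have hpos : 0 < ⟪y - x, y - x⟫ := inner_self_pos_of_ne (sub_ne_zero.2 hxy.symm)
  constructor
  · obtain ⟨u, hu⟩ := exists_tilted_halfPlane ((P.erase x).image fun w => w - x) (perp (y - x))
      (y - x) (by
        intro a ha
        obtain ⟨w, hw, rfl⟩ := Finset.mem_image.1 ha
        obtain ⟨hwx, hwP⟩ := Finset.mem_erase.1 hw
        rw [inner_perp]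
        by_cases hwy : w = y
        · subst hwy
          exact Or.inr ⟨det2_self _, hpos⟩
        · exact Or.inl (hz w hwP hwx hwy))
    exact ⟨hx, u, fun w hw hwx => hu _ (Finset.mem_image.2
      ⟨w, Finset.mem_erase.2 ⟨hwx, hw⟩, rfl⟩)⟩
  · obtain ⟨u, hu⟩ := exists_tilted_halfPlane ((P.erase y).image fun w => w - y) (perp (y - x))
      (x - y) (by
        intro a ha
        obtain ⟨w, hw, rfl⟩ := Finset.mem_image.1 ha
        obtain ⟨hwy, hwP⟩ := Finset.mem_erase.1 hw
        have e1 : det2 (y - x) (w - y) = det2 (y - x) (w - x) := by simp [det2]; ring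
        rw [inner_perp, e1]
        by_cases hwx : w = x
        · subst hwx
          exact Or.inr ⟨by simp [det2], by rwa [← inner_neg_neg, neg_sub]⟩
        · exact Or.inl (hz w hwP hwx hwy))
    exact ⟨hy, u, fun w hw hwy => hu _ (Finset.mem_image.2
      ⟨w, Finset.mem_erase.2 ⟨hwy, hw⟩, rfl⟩)⟩

lemma Extreme.exists_hullEdge {P : Finset Pt} (hgen : GeneralPosition P) {x : Pt}
    (h : Extreme P x) (hne : ∃ z ∈ P, z ≠ x) : (∃ y, HullEdge P x y) ∧ ∃ y, HullEdge P y x := by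
  obtain ⟨hx, u, hu⟩ := h
  obtain ⟨z, hz, hzx⟩ := hne
  obtain ⟨⟨a, ha, ha'⟩, ⟨c, hc, hc'⟩⟩ := exists_first_last (W := (P.erase x).image fun w => w - x)
    (u := u) ⟨z - x, Finset.mem_image.2 ⟨z, by simp [hz, hzx], rfl⟩⟩
    (by
      intro a ha
      obtain ⟨w, hw, rfl⟩ := Finset.mem_image.1 ha
      obtain ⟨hwx, hwP⟩ := Finset.mem_erase.1 hw
      exact hu w hwP hwx)
    (by
      intro a ha b hb hab
      obtain ⟨p, hp, rfl⟩ := Finset.mem_image.1 ha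
      obtain ⟨q, hq, rfl⟩ := Finset.mem_image.1 hb
      obtain ⟨hpx, hpP⟩ := Finset.mem_erase.1 hp
      obtain ⟨hqx, hqP⟩ := Finset.mem_erase.1 hq
      exact det2_ne_zero_of_generalPosition hgen hx hpP hqP hpx.symm hqx.symm
        (by rintro rfl; exact hab rfl))
  obtain ⟨y, hy, rfl⟩ := Finset.mem_image.1 ha
  obtain ⟨y', hy', rfl⟩ := Finset.mem_image.1 hc
  obtain ⟨hyx, hyP⟩ := Finset.mem_erase.1 hy
  obtain ⟨hyx', hyP'⟩ := Finset.mem_erase.1 hy'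
  refine ⟨⟨y, hx, hyP, hyx.symm, fun z hz hzx hzy => ?_⟩,
    ⟨y', hyP', hx, hyx', fun z hz hzy hzx => ?_⟩⟩
  · exact ha' _ (Finset.mem_image.2 ⟨z, by simp [hz, hzx], rfl⟩) (by simpa using hzy)
  · have := hc' _ (Finset.mem_image.2 ⟨z, by simp [hz, hzx], rfl⟩) (by simpa using hzy)
    have e1 : det2 (x - y') (z - y') = det2 (z - x) (y' - x) := by simp [det2]; ring
    rwa [e1]

lemma HullEdge.right_unique {P : Finset Pt} {x y y' : Pt} (h : HullEdge P x y)
    (h' : HullEdge P x y') : y = y' := by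
  by_contra hne
  have h1 := h.2.2.2 y' h'.2.1 h'.2.2.1.symm (Ne.symm hne)
  have h2 := h'.2.2.2 y h.2.1 h.2.2.1.symm hne
  rw [det2_comm] at h2
  linarith

lemma HullEdge.left_unique {P : Finset Pt} {x y y' : Pt} (h : HullEdge P y x)
    (h' : HullEdge P y' x) : y = y' := by
  by_contra hne
  have h1 := h.2.2.2 y' h'.1 (Ne.symm hne) h'.2.2.1
  have h2 := h'.2.2.2 y h.1 hne h.2.2.1
  have e1 : det2 (x - y') (y - y') = -det2 (x - y) (y' - y) := by simp [det2]; ring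
  rw [e1] at h2
  linarith

lemma exists_extreme {P : Finset Pt} (hP : P.Nonempty) : ∃ x, Extreme P x := by
  obtain ⟨p, hp, hmax⟩ := P.exists_max_image (fun p => ‖p‖) hP
  refine ⟨p, hp, -p, fun w hw hwp => ?_⟩
  have h1 : 0 < ‖w - p‖ := norm_pos_iff.2 (sub_ne_zero.2 hwp)
  have h2 := norm_sub_sq_real w p
  have h3 := hmax w hw
  rw [inner_neg_left, inner_sub_right, real_inner_self_eq_norm_sq, real_inner_comm]
  nlinarith [norm_nonneg w, norm_nonneg p]

lemma Extreme.mem_hullVertices {P : Finset Pt} {x : Pt} (h : Extreme P x)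
    (hne : ∃ z ∈ P, z ≠ x) : x ∈ hullVertices P := by
  obtain ⟨hx, u, hu⟩ := h
  obtain ⟨z, hz, hzx⟩ := hne
  have hu0 : u ≠ 0 := by
    rintro rfl
    have := hu z hz hzx
    simp at this
  refine Finset.mem_filter.2 ⟨hx, subset_closure (subset_convexHull ℝ _ hx), fun hint => ?_⟩
  have hsub : convexHull ℝ (P : Set Pt) ⊆ {y | ⟪u, x⟫ ≤ ⟪u, y⟫} := by
    refine convexHull_min (fun w hw => ?_) ?_
    · by_cases hwx : w = x
      · subst hwx; exact le_refl ⟪u, w⟫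
      · have := hu w hw hwx
        rw [inner_sub_right] at this
        exact (sub_pos.1 this).le
    · exact convex_halfSpace_ge (innerₛₗ ℝ u).isLinear _
  have hc : Tendsto (fun t : ℝ => x - t • u) (𝓝[>] 0) (𝓝 x) := by
    have : Tendsto (fun t : ℝ => x - t • u) (𝓝 0) (𝓝 (x - (0 : ℝ) • u)) :=
      Continuous.tendsto (by fun_prop) 0
    rw [zero_smul, sub_zero] at this
    exact this.mono_left nhdsWithin_le_nhds
  obtain ⟨t, ht, ht0⟩ := ((hc.eventually (mem_interior_iff_mem_nhds.1 hint)).and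
    self_mem_nhdsWithin).exists
  have h1 : ⟪u, x⟫ ≤ ⟪u, x - t • u⟫ := hsub ht
  rw [inner_sub_right, inner_smul_right] at h1
  have := mul_pos ht0 (inner_self_pos_of_ne hu0)
  linarith

/-- Adding an uncrossed edge to a plane graph. -/
noncomputable def PlaneGraph.addEdge {P : Finset Pt} (hgen : GeneralPosition P) (G : PlaneGraph P)
    (e : Sym2 Pt) (he : e ∈ pairs P) (h : ∀ f ∈ G.edges, f ≠ e → oseg e ∩ oseg f = ∅) :
    PlaneGraph P where
  edges := insert e G.edges
  not_isDiag f hf := by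
    rcases Finset.mem_insert.1 hf with rfl | hf
    · exact (Finset.mem_filter.1 he).2
    · exact G.not_isDiag f hf
  endpoints_mem f hf := by
    rcases Finset.mem_insert.1 hf with rfl | hf
    · exact Finset.mem_sym2_iff.1 (Finset.mem_filter.1 he).1
    · exact G.endpoints_mem f hf
  noncrossing f hf g hg hfg := by
    rcases Finset.mem_insert.1 hf with rfl | hf' <;> rcases Finset.mem_insert.1 hg with rfl | hg'
    · exact absurd rfl hfg
    · exact h g hg' hfg.symm
    · rw [Set.inter_comm]; exact h f hf' hfg
    · exact G.noncrossing f hf' g hg' hfg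
  no_vertex_interior f hf r hr := by
    rcases Finset.mem_insert.1 hf with rfl | hf
    · induction f with | _ p q
      obtain ⟨hp, hq, hpq⟩ := mk_mem_pairs.1 he
      exact notMem_openSegment_of_generalPosition hgen hp hq hr hpq
    · exact G.no_vertex_interior f hf r hr

lemma HullEdge.mem_edges {P : Finset Pt} (hgen : GeneralPosition P) {G : PlaneGraph P}
    (hG : IsPointedPseudoTriangulation G) {x y : Pt} (h : HullEdge P x y) :
    s(x, y) ∈ G.edges := by
  obtain ⟨hx, hy, hxy, hz⟩ := h
  have hnn : ∀ p ∈ P, 0 ≤ det2 (y - x) (p - x) := by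
    intro p hp
    by_cases h1 : p = x
    · simp [h1, det2]
    by_cases h2 : p = y
    · simp [h2]
    exact (hz p hp h1 h2).le
  have hnc : ∀ f ∈ G.edges, f ≠ s(x, y) → oseg s(x, y) ∩ oseg f = ∅ := by
    intro f hf hne
    rw [Set.eq_empty_iff_forall_notMem]
    rintro w ⟨hw1, hw2⟩
    induction f with | _ p q
    obtain ⟨hp, hq, hpq⟩ := mk_mem_pairs.1 (G.edges_subset_pairs hf)
    have h0 : det2 (y - x) (w - x) = 0 := by
      have := (det2_eq_zero_of_mem_openSegment hw1).1
      rw [← neg_eq_zero, ← this]; simp [det2]; ring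
    obtain ⟨a, b, ha, hb, hab, rfl⟩ := hw2
    have h1 : det2 (y - x) (a • p + b • q - x)
        = a * det2 (y - x) (p - x) + b * det2 (y - x) (q - x) := by
      obtain rfl : a = 1 - b := by linarith
      simp [det2]; ring
    have hp0 : ¬ 0 < det2 (y - x) (p - x) := fun h2 => by
      have := mul_nonneg hb.le (hnn q hq)
      have := mul_pos ha h2
      linarith
    have hq0 : ¬ 0 < det2 (y - x) (q - x) := fun h2 => by
      have := mul_nonneg ha.le (hnn p hp)
      have := mul_pos hb h2
      linarith
    have hp1 : p = x ∨ p = y := by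
      by_contra! hh; exact hp0 (hz p hp hh.1 hh.2)
    have hq1 : q = x ∨ q = y := by
      by_contra! hh; exact hq0 (hz q hq hh.1 hh.2)
    rcases hp1 with rfl | rfl <;> rcases hq1 with rfl | rfl
    · exact hpq rfl
    · exact hne rfl
    · exact hne Sym2.eq_swap
    · exact hpq rfl
  set G' := G.addEdge hgen s(x, y) (mk_mem_pairs.2 ⟨hx, hy, hxy⟩) hnc with hG'
  have hpt : PointedGraph G' := by
    intro w hw
    have hext : Extreme P w → PointedAt G' w := by
      rintro ⟨-, u, hu⟩
      exact ⟨u, fun e he _ r hr hrw => hu r (G'.endpoints_mem e he r hr) hrw⟩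
    obtain ⟨hex, hey⟩ := HullEdge.extreme ⟨hx, hy, hxy, hz⟩
    by_cases h1 : w = x
    · rw [h1] at hext ⊢; exact hext hex
    by_cases h2 : w = y
    · rw [h2] at hext ⊢; exact hext hey
    obtain ⟨u, hu⟩ := hG.1 w hw
    refine ⟨u, fun e he hwe => hu e ?_ hwe⟩
    refine (Finset.mem_insert.1 he).resolve_left ?_
    rintro rfl
    rcases Sym2.mem_iff.1 hwe with rfl | rfl
    · exact h1 rfl
    · exact h2 rfl
  rw [← hG.2 G' hpt (Finset.subset_insert _ _)]
  exact Finset.mem_insert_self _ _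

lemma hull_term_eq (a b α β : Pt) :
    ⟪a - b, α - β⟫ = ⟪a - b, α⟫ + ⟪b - a, β⟫ := by
  simp only [inner_eq_coord, PiLp.sub_apply]; ring

lemma hull_vertex_coefficient {a b c α : Pt} (hab : det2 a b ≠ 0) (hca : det2 c a ≠ 0) :
    ⟪a - b, α⟫ / det2 a b + ⟪a - c, α⟫ / det2 c a
      = det2 (a - c) (b - c) / (det2 a b * det2 c a) * ⟪a, α⟫ := by
  field_simp
  simp only [inner_eq_coord, det2, PiLp.sub_apply]
  ring

/-- An expansive motion preserving the hull edges preserves the distances from any interior point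
to the hull vertices. -/
lemma stretch_eq_zero_of_hull {P : Finset Pt} (hgen : GeneralPosition P) {m : Pt → Pt}
    (hm : ∀ e ∈ pairs P, 0 ≤ stretch e m)
    (hull : ∀ x y, HullEdge P x y → stretch s(x, y) m = 0)
    {z : Pt} (hz : z ∈ P) (hzX : ¬ Extreme P z) {x : Pt} (hx : Extreme P x) :
    stretch s(z, x) m = 0 := by
  set X := P.filter (Extreme P) with hX
  have hmem : ∀ x, x ∈ X ↔ Extreme P x := fun x => by
    simpa [hX] using fun h : Extreme P x => h.1
  have hne : ∀ x, Extreme P x → z ≠ x := by rintro x h rfl; exact hzX h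
  have hse : ∀ x ∈ X, ∃ y, HullEdge P x y := fun x h =>
    (((hmem x).1 h).exists_hullEdge hgen ⟨z, hz, hne x ((hmem x).1 h)⟩).1
  have hpe : ∀ x ∈ X, ∃ y, HullEdge P y x := fun x h =>
    (((hmem x).1 h).exists_hullEdge hgen ⟨z, hz, hne x ((hmem x).1 h)⟩).2
  choose! σ hσ using hse
  choose! π hπ using hpe
  have hσX : ∀ x ∈ X, σ x ∈ X := fun x h => (hmem _).2 (hσ x h).extreme.2
  have hπX : ∀ x ∈ X, π x ∈ X := fun x h => (hmem _).2 (hπ x h).extreme.1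
  have hπσ : ∀ x ∈ X, π (σ x) = x := fun x h => (hπ _ (hσX x h)).left_unique (hσ x h)
  have hσπ : ∀ x ∈ X, σ (π x) = x := fun x h => (hσ _ (hπX x h)).right_unique (hπ x h)
  have hD : ∀ {x y}, HullEdge P x y → 0 < det2 (x - z) (y - z) := by
    intro x y h
    have h1 := h.2.2.2 z hz (hne x h.extreme.1) (hne y h.extreme.2)
    have e1 : det2 (x - z) (y - z) = det2 (y - x) (z - x) := by simp [det2]; ring
    rwa [e1]
  have h1 : ∑ x ∈ X, (⟪(x - z) - (σ x - z), m x - m z⟫ / det2 (x - z) (σ x - z)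
      + ⟪(σ x - z) - (x - z), m (σ x) - m z⟫ / det2 (x - z) (σ x - z)) = 0 := by
    refine Finset.sum_eq_zero fun x h => ?_
    have h2 := hull _ _ (hσ x h)
    rw [stretch_mk] at h2
    rw [← add_div, ← hull_term_eq, sub_sub_sub_cancel_right, sub_sub_sub_cancel_right, h2, zero_div]
  have h2 : ∑ x ∈ X, ⟪(σ x - z) - (x - z), m (σ x) - m z⟫ / det2 (x - z) (σ x - z)
      = ∑ x ∈ X, ⟪(x - z) - (π x - z), m x - m z⟫ / det2 (π x - z) (x - z) := by
    refine Finset.sum_bij' (fun x _ => σ x) (fun x _ => π x) hσX hπX hπσ hσπ fun x h => ?_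
    rw [hπσ x h]
  rw [Finset.sum_add_distrib, h2, ← Finset.sum_add_distrib] at h1
  have hnn : ∀ x ∈ X, 0 ≤ ⟪x - z, m x - m z⟫ := fun x h => by
    have h3 : x ∈ P := ((hmem x).1 h).1
    exact hm _ (mk_mem_pairs.2 ⟨h3, hz, (hne x ((hmem x).1 h)).symm⟩)
  have hs : ∀ x ∈ X, 0 < det2 ((x - z) - (π x - z)) ((σ x - z) - (π x - z))
      / (det2 (x - z) (σ x - z) * det2 (π x - z) (x - z)) := by
    intro x h
    refine div_pos ?_ (mul_pos (hD (hσ x h)) (hD (hπ x h)))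
    rw [sub_sub_sub_cancel_right, sub_sub_sub_cancel_right]
    have hxe := (hmem x).1 h
    refine (hπ x h).2.2.2 _ (hσ x h).2.1 (fun heq => ?_) (hσ x h).2.2.1.symm
    have h3 := hD (hπ x h)
    have h4 := hD (hσ x h)
    rw [heq, det2_comm] at h4
    linarith
  have hterm : ∀ x ∈ X, 0 ≤ ⟪(x - z) - (σ x - z), m x - m z⟫ / det2 (x - z) (σ x - z)
      + ⟪(x - z) - (π x - z), m x - m z⟫ / det2 (π x - z) (x - z) := by
    intro x h
    rw [hull_vertex_coefficient (hD (hσ x h)).ne' (hD (hπ x h)).ne']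
    exact mul_nonneg (hs x h).le (hnn x h)
  have hxX := (hmem x).2 hx
  have h3 := (Finset.sum_eq_zero_iff_of_nonneg hterm).1 h1 x hxX
  rw [hull_vertex_coefficient (hD (hσ x hxX)).ne' (hD (hπ x hxX)).ne'] at h3
  have h4 := (mul_eq_zero.1 h3).resolve_left (hs x hxX).ne'
  rw [Sym2.eq_swap]
  exact h4

lemma stretch_eq_zero_of_four_points {v a x y : Pt} {m : Pt → Pt}
    (h1 : stretch s(v, x) m = 0) (h2 : stretch s(v, y) m = 0) (h3 : stretch s(a, x) m = 0)
    (h4 : stretch s(a, y) m = 0) (h5 : stretch s(x, y) m = 0)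
    (hv : det2 (x - v) (y - v) ≠ 0) (ha : det2 (x - a) (y - a) ≠ 0) :
    stretch s(v, a) m = 0 := by
  have key : det2 (x - v) (y - v) * det2 (x - a) (y - a) * stretch s(v, a) m = 0 := by
    obtain ⟨A, hA⟩ : ∃ A, A = det2 (x - v) (y - v) := ⟨_, rfl⟩
    obtain ⟨B, hB⟩ : ∃ B, B = det2 (a - v) (y - v) := ⟨_, rfl⟩
    obtain ⟨C, hC⟩ : ∃ C, C = det2 (x - v) (a - v) := ⟨_, rfl⟩
    have hE : det2 (x - a) (y - a) = A - B - C := by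
      simp [hA, hB, hC, det2]; ring
    have k0 : A * (a 0 - v 0) = B * (x 0 - v 0) + C * (y 0 - v 0) := by
      simp [hA, hB, hC, det2]; ring
    have k1 : A * (a 1 - v 1) = B * (x 1 - v 1) + C * (y 1 - v 1) := by
      simp [hA, hB, hC, det2]; ring
    rw [hE, ← hA]
    simp only [stretch_mk, inner_eq_coord, PiLp.sub_apply] at *
    clear hE hA hB hC hv ha
    generalize m v 0 = mv0 at *
    generalize m v 1 = mv1 at *
    generalize m a 0 = ma0 at *
    generalize m a 1 = ma1 at *
    generalize m x 0 = mx0 at *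
    generalize m x 1 = mx1 at *
    generalize m y 0 = my0 at *
    generalize m y 1 = my1 at *
    linear_combination (A - B - C) * (B * h1 + C * h2) - A * B * h3 - A * C * h4 + B * C * h5
      - ((A - B - C) * mv0 + B * mx0 + C * my0 - A * ma0) * k0
      - ((A - B - C) * mv1 + B * mx1 + C * my1 - A * ma1) * k1
  exact (mul_eq_zero.1 key).resolve_left (mul_ne_zero hv ha)

/-- Every edge at a vertex in the interior of the convex hull can be flipped. -/
theorem exists_flip_of_interior {P : Finset Pt} (hgen : GeneralPosition P) {G : PlaneGraph P}
    (hG : IsPointedPseudoTriangulation G) {v a : Pt} (hv : v ∈ P) (hvint : v ∉ hullVertices P)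
    (he : s(v, a) ∈ G.edges) : ∃ (G' : PlaneGraph P) (e' : Sym2 Pt), PPTFlip G G' s(v, a) e' := by
  obtain ⟨-, ha, hva⟩ := mk_mem_pairs.1 (G.edges_subset_pairs he)
  obtain ⟨m, hm1, hm0⟩ := hG.1.hasDualVectors hgen _ he
  by_cases hneg : ∃ e' ∈ pairs P, stretch e' m < 0
  · exact exists_flip_of_not_expansive hgen hG he hm1 hm0 hneg
  push Not at hneg
  exfalso
  have hvX : ¬ Extreme P v := fun h => hvint (h.mem_hullVertices ⟨a, ha, hva.symm⟩)
  have hull : ∀ x y, HullEdge P x y → stretch s(x, y) m = 0 := by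
    intro x y h
    refine hm0 _ (h.mem_edges hgen hG) fun heq => ?_
    rcases Sym2.eq_iff.1 heq with ⟨rfl, -⟩ | ⟨-, rfl⟩
    · exact hvX h.extreme.1
    · exact hvX h.extreme.2
  have hv0 : ∀ x, Extreme P x → stretch s(v, x) m = 0 := fun x hx =>
    stretch_eq_zero_of_hull hgen hneg hull hv hvX hx
  suffices h : stretch s(v, a) m = 0 by rw [h] at hm1; exact zero_ne_one hm1
  by_cases haX : Extreme P a
  · exact hv0 a haX
  have ha0 : ∀ x, Extreme P x → stretch s(a, x) m = 0 := fun x hx =>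
    stretch_eq_zero_of_hull hgen hneg hull ha haX hx
  obtain ⟨x, hx⟩ := exists_extreme ⟨v, hv⟩
  have hvx : v ≠ x := by rintro rfl; exact hvX hx
  obtain ⟨⟨y, hxy⟩, -⟩ := hx.exists_hullEdge hgen ⟨v, hv, hvx⟩
  have hy := hxy.extreme.2
  have hvy : v ≠ y := by rintro rfl; exact hvX hy
  have hax : a ≠ x := by rintro rfl; exact haX hx
  have hay : a ≠ y := by rintro rfl; exact haX hy
  exact stretch_eq_zero_of_four_points (hv0 x hx) (hv0 y hy) (ha0 x hx) (ha0 y hy) (hull x y hxy)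
    (det2_ne_zero_of_generalPosition hgen hv hx.1 hy.1 hvx hvy hxy.2.2.1)
    (det2_ne_zero_of_generalPosition hgen ha hx.1 hy.1 hax hay hxy.2.2.1)

lemma pointedAt_iff {P : Finset Pt} {G : PlaneGraph P} {q : Pt} :
    PointedAt G q ↔ ∃ u : Pt, ∀ x, s(q, x) ∈ G.edges → 0 < ⟪u, x - q⟫ := by
  constructor
  · rintro ⟨u, hu⟩
    refine ⟨u, fun x hx => hu _ hx (Sym2.mem_mk_left _ _) x (Sym2.mem_mk_right _ _) ?_⟩
    exact (mk_mem_pairs.1 (G.edges_subset_pairs hx)).2.2.symm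
  · rintro ⟨u, hu⟩
    refine ⟨u, fun e he hq w hw hwq => hu w ?_⟩
    rwa [← (Sym2.mem_and_mem_iff hwq.symm).1 ⟨hq, hw⟩]

lemma oseg_inter_oseg_of_common_endpoint {P : Finset Pt} (hgen : GeneralPosition P) {v a b : Pt}
    (hv : v ∈ P) (ha : a ∈ P) (hb : b ∈ P) (hva : v ≠ a) (hvb : v ≠ b) (hab : a ≠ b) :
    oseg s(v, a) ∩ oseg s(v, b) = ∅ := by
  rw [Set.eq_empty_iff_forall_notMem]
  rintro x ⟨hxa, hxb⟩
  have h1 := (det2_eq_zero_of_mem_openSegment hxa).1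
  have h2 := (det2_eq_zero_of_mem_openSegment hxb).1
  have h3 := det2_cramer (a - v) (b - v) (v - x)
  rw [h2, det2_comm (v - x), h1, neg_zero, zero_smul, zero_smul, add_zero, add_zero] at h3
  rcases smul_eq_zero.1 h3 with h4 | h4
  · exact det2_ne_zero_of_generalPosition hgen hv ha hb hva hvb hab h4
  · rw [← sub_eq_zero.1 h4] at hxa
    exact notMem_openSegment_of_generalPosition hgen hv ha hv hva hxa

/-- The segment from `v` to `w` is not in `G`, crosses no edge of `G`, and can be added while
keeping all vertices other than `v` pointed. -/
structure Addable {P : Finset Pt} (G : PlaneGraph P) (v w : Pt) : Prop where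
  mem_pairs : s(v, w) ∈ pairs P
  notMem : s(v, w) ∉ G.edges
  noncrossing : ∀ f ∈ G.edges, f ≠ s(v, w) → oseg s(v, w) ∩ oseg f = ∅
  pointed : ∀ q ∈ P, q ≠ v → ∃ u : Pt, ∀ x, s(q, x) ∈ insert s(v, w) G.edges → 0 < ⟪u, x - q⟫

/-- A flip inserting an edge at an endpoint of the removed edge. -/
lemma PPTFlip.exists_addable {P : Finset Pt} (hgen : GeneralPosition P) {G G' : PlaneGraph P}
    {v a : Pt} {e' : Sym2 Pt} (h : PPTFlip G G' s(v, a) e') (hv : v ∈ e') :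
    ∃ w, Addable G v w ∧
      ∃ u : Pt, ∀ x, x ≠ a → s(v, x) ∈ insert s(v, w) G.edges → 0 < ⟪u, x - v⟫ := by
  obtain ⟨hG, hG', he, he', hE⟩ := h
  obtain ⟨w, rfl⟩ := hv
  have hmem : s(v, w) ∈ G'.edges := by rw [hE]; exact Finset.mem_insert_self _ _
  have hpw := G'.edges_subset_pairs hmem
  obtain ⟨hvP, hwP, hvw⟩ := mk_mem_pairs.1 hpw
  obtain ⟨-, haP, hva⟩ := mk_mem_pairs.1 (G.edges_subset_pairs he)
  have hwa : w ≠ a := by rintro rfl; exact he' he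
  have hsub : ∀ f ∈ insert s(v, w) G.edges, f ≠ s(v, a) → f ∈ G'.edges := by
    intro f hf hne
    rw [hE]
    rcases Finset.mem_insert.1 hf with rfl | hf
    · exact Finset.mem_insert_self _ _
    · exact Finset.mem_insert_of_mem (Finset.mem_erase.2 ⟨hne, hf⟩)
  refine ⟨w, ⟨hpw, he', fun f hf hne => ?_, fun q hq hqv => ?_⟩, ?_⟩
  · by_cases hfa : f = s(v, a)
    · rw [hfa]
      exact oseg_inter_oseg_of_common_endpoint hgen hvP hwP haP hvw hva hwa
    · exact G'.noncrossing _ hmem _ (hsub f (Finset.mem_insert_of_mem hf) hfa) hne.symm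
  · by_cases hqa : q = a
    · obtain ⟨u, hu⟩ := pointedAt_iff.1 (hG.1 q hq)
      refine ⟨u, fun x hx => hu x ((Finset.mem_insert.1 hx).resolve_left fun heq => ?_)⟩
      have : q ∈ s(v, w) := heq ▸ Sym2.mem_mk_left q x
      rcases Sym2.mem_iff.1 this with h1 | h1
      · exact hqv h1
      · exact hwa (h1.symm.trans hqa)
    · obtain ⟨u, hu⟩ := pointedAt_iff.1 (hG'.1 q hq)
      refine ⟨u, fun x hx => hu x (hsub _ hx fun heq => ?_)⟩
      have : q ∈ s(v, a) := heq ▸ Sym2.mem_mk_left q x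
      rcases Sym2.mem_iff.1 this with h1 | h1
      · exact hqv h1
      · exact hqa h1
  · obtain ⟨u, hu⟩ := pointedAt_iff.1 (hG'.1 v hvP)
    refine ⟨u, fun x hxa hx => hu x (hsub _ hx fun heq => hxa ?_)⟩
    exact Sym2.congr_right.1 heq

/-- Adding an edge to a pointed pseudo-triangulation creates a self-stress. -/
lemma IsPointedPseudoTriangulation.exists_stress {P : Finset Pt} (hgen : GeneralPosition P)
    {G : PlaneGraph P} (hG : IsPointedPseudoTriangulation G) {e : Sym2 Pt} (he : e ∈ pairs P)
    (heG : e ∉ G.edges) :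
    ∃ σ, IsStress P σ ∧ σ e ≠ 0 ∧ ∀ f, f ∉ insert e G.edges → σ f = 0 := by
  obtain ⟨-, -, -, hR⟩ := hG.exists_feasible hgen
  obtain ⟨c, hc⟩ := exists_combination_of_rigidSet hR (hG.1.hasDualVectors hgen) he
  refine ⟨_, isStress_of_combination (A := G.edges) (B := {e}) (a := c) (b := fun _ => 1)
    G.edges_subset_pairs (by simpa using he) (fun m => by rw [hc m]; simp), ?_, ?_⟩
  · simp [heG]
  · intro f hf
    rw [Finset.mem_insert, not_or] at hf
    simp [hf.1, hf.2]

/-- Two distinct edges at a vertex cannot both be added without creating non-pointed vertices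
elsewhere. -/
lemma Addable.eq {P : Finset Pt} (hgen : GeneralPosition P) {G : PlaneGraph P}
    (hG : IsPointedPseudoTriangulation G) {v w w' : Pt} (h : Addable G v w)
    (h' : Addable G v w') : w = w' := by
  by_contra hww
  obtain ⟨hv, hw, hvw⟩ := mk_mem_pairs.1 h.mem_pairs
  obtain ⟨-, hw', hvw'⟩ := mk_mem_pairs.1 h'.mem_pairs
  have hne : s(v, w) ≠ s(v, w') := fun heq => hww (Sym2.congr_right.1 heq)
  obtain ⟨σ, hσ, hσe, hσ0⟩ := hG.exists_stress hgen h.mem_pairs h.notMem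
  obtain ⟨τ, hτ, hτe, hτ0⟩ := hG.exists_stress hgen h'.mem_pairs h'.notMem
  have hpt : ∀ {K : PlaneGraph P} {ω : Sym2 Pt → ℝ}, IsStress P ω →
      (∀ e ∈ pairs P, e ∉ K.edges → ω e = 0) → (∀ q ∈ P, q ≠ v → PointedAt K q) →
      height P ω v = 0 → ∀ e ∈ pairs P, ω e = 0 := by
    intro K ω hω hsupp hK h0
    refine hω.eq_zero_of_sign hgen K K (fun e he heK => (hsupp e he heK).ge)
      (fun e he heK => (hsupp e he heK).le) (fun q hq => ?_) (fun q hq => ?_)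
    · by_cases hqv : q = v
      · rw [hqv]; exact Or.inr h0.le
      · exact Or.inl (hK q hq hqv)
    · by_cases hqv : q = v
      · rw [hqv]; exact Or.inr h0.ge
      · exact Or.inl (hK q hq hqv)
  have hτv : height P τ v ≠ 0 := fun h0 => hτe <|
    hpt (K := G.addEdge hgen _ h'.mem_pairs h'.noncrossing) hτ (fun e _ heK => hτ0 e heK)
      (fun q hq hqv => pointedAt_iff.2 (h'.pointed q hq hqv)) h0 _ h'.mem_pairs
  have hnc : ∀ f ∈ (G.addEdge hgen _ h'.mem_pairs h'.noncrossing).edges, f ≠ s(v, w) →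
      oseg s(v, w) ∩ oseg f = ∅ := by
    intro f hf hfw
    rcases Finset.mem_insert.1 hf with rfl | hf
    · exact oseg_inter_oseg_of_common_endpoint hgen hv hw hw' hvw hvw' hww
    · exact h.noncrossing f hf hfw
  have hω := hpt (K := (G.addEdge hgen _ h'.mem_pairs h'.noncrossing).addEdge hgen _
    h.mem_pairs hnc) (hσ.linear hτ (height P τ v) (-height P σ v)) ?_ ?_ ?_ _ h.mem_pairs
  · have hτw : τ s(v, w) = 0 := hτ0 _ fun hmem =>
      (Finset.mem_insert.1 hmem).elim hne h.notMem
    simp only [hτw, mul_zero, add_zero] at hω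
    exact (mul_ne_zero hτv hσe) hω
  · intro e _ he
    have h1 : e ∉ insert s(v, w) (insert s(v, w') G.edges) := he
    simp only [Finset.mem_insert, not_or] at h1
    rw [hσ0 e (by simp [h1.1, h1.2.2]), hτ0 e (by simp [h1.2.1, h1.2.2])]
    simp
  · intro q hq hqv
    rw [pointedAt_iff]
    by_cases hqw : q = w
    · obtain ⟨u, hu⟩ := h.pointed q hq hqv
      refine ⟨u, fun x hx => hu x ?_⟩
      refine (Finset.mem_insert.1 hx).elim (fun h1 => h1 ▸ Finset.mem_insert_self _ _)
        fun h1 => Finset.mem_insert_of_mem ((Finset.mem_insert.1 h1).resolve_left fun heq => ?_)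
      have : q ∈ s(v, w') := heq ▸ Sym2.mem_mk_left q x
      rcases Sym2.mem_iff.1 this with h2 | h2
      · exact hqv h2
      · exact hww (hqw.symm.trans h2)
    · obtain ⟨u, hu⟩ := h'.pointed q hq hqv
      refine ⟨u, fun x hx => hu x ((Finset.mem_insert.1 hx).resolve_left fun heq => ?_)⟩
      have : q ∈ s(v, w) := heq ▸ Sym2.mem_mk_left q x
      rcases Sym2.mem_iff.1 this with h2 | h2
      · exact hqv h2
      · exact hqw h2
  · rw [height_linear]; ring

/-- Four vectors lie in an open half-plane if two suitable triples of them do. -/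
lemma exists_halfPlane_of_triples {a b c w u u' : Pt} (hab : 0 < det2 a b) (hac : 0 < det2 a c)
    (hbc : 0 < det2 b c) (haw : det2 a w ≠ 0) (hwc : det2 w c ≠ 0)
    (hub : 0 < ⟪u, b⟫) (huc : 0 < ⟪u, c⟫) (huw : 0 < ⟪u, w⟫)
    (hua' : 0 < ⟪u', a⟫) (hub' : 0 < ⟪u', b⟫) (huw' : 0 < ⟪u', w⟫) :
    ∃ n : Pt, 0 < ⟪n, a⟫ ∧ 0 < ⟪n, b⟫ ∧ 0 < ⟪n, c⟫ ∧ 0 < ⟪n, w⟫ := by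
  have hne : ∀ {x y : Pt}, 0 < det2 x y → 0 < ⟪x, x⟫ ∧ 0 < ⟪y, y⟫ := by
    intro x y hxy
    constructor <;> refine inner_self_pos_of_ne ?_ <;> rintro rfl <;> simp [det2] at hxy
  rcases haw.lt_or_gt with h1 | h1
  · rcases hwc.lt_or_gt with h2 | h2
    · exfalso
      rw [det2_comm, neg_lt_zero] at h1 h2
      rcases le_total 0 (det2 b w) with h3 | h3
      · have h4 := congrArg (fun x : Pt => ⟪u', x⟫) (det2_cramer a b w)
        simp only [inner_add_right, inner_smul_right, inner_zero_right] at h4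
        have := mul_pos hab huw'
        have := mul_nonneg h3 hua'.le
        have := mul_pos h1 hub'
        linarith
      · have h4 := congrArg (fun x : Pt => ⟪u, x⟫) (det2_cramer b c w)
        simp only [inner_add_right, inner_smul_right, inner_zero_right] at h4
        rw [det2_comm, neg_nonpos] at h3
        have := mul_pos hbc huw
        have := mul_pos h2 hub
        have := mul_nonneg h3 huc.le
        linarith
    · obtain ⟨n, hn⟩ := exists_tilted_halfPlane {a, b, c, w} (-perp c) c (by
        simp only [Finset.mem_insert, Finset.mem_singleton, forall_eq_or_imp, forall_eq,
          inner_neg_left, inner_perp, ← det2_comm, det2_self]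
        exact ⟨Or.inl hac, Or.inl hbc, Or.inr ⟨trivial, (hne hac).2⟩, Or.inl h2⟩)
      exact ⟨n, by simpa using hn⟩
  · obtain ⟨n, hn⟩ := exists_tilted_halfPlane {a, b, c, w} (perp a) a (by
      simp only [Finset.mem_insert, Finset.mem_singleton, forall_eq_or_imp, forall_eq,
        inner_perp, det2_self]
      exact ⟨Or.inr ⟨trivial, (hne hac).1⟩, Or.inl hab, Or.inl hac, Or.inl h1⟩)
    exact ⟨n, by simpa using hn⟩

/-- The neighbours of a vertex of degree three, in counterclockwise order. -/
lemma exists_neighbors_of_degree_three {P : Finset Pt} (hgen : GeneralPosition P)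
    {G : PlaneGraph P} {v : Pt} (hv : v ∈ P) (hpt : PointedAt G v)
    (hdeg : (G.edges.filter fun e => v ∈ e).card = 3) :
    ∃ a b c, (∀ x, s(v, x) ∈ G.edges ↔ x = a ∨ x = b ∨ x = c) ∧ 0 < det2 (a - v) (b - v) ∧
      0 < det2 (a - v) (c - v) ∧ 0 < det2 (b - v) (c - v) := by
  have hpairs : ∀ {x}, s(v, x) ∈ G.edges → x ∈ P ∧ v ≠ x := fun hx =>
    (mk_mem_pairs.1 (G.edges_subset_pairs hx)).2
  set N := P.filter fun x => s(v, x) ∈ G.edges with hN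
  have hNmem : ∀ x, x ∈ N ↔ s(v, x) ∈ G.edges := fun x => by
    rw [hN, Finset.mem_filter]
    exact ⟨fun h => h.2, fun h => ⟨(hpairs h).1, h⟩⟩
  have himg : (G.edges.filter fun e => v ∈ e) = N.image fun x => s(v, x) := by
    ext e
    simp only [Finset.mem_filter, Finset.mem_image, hNmem]
    constructor
    · rintro ⟨he, x, rfl⟩
      exact ⟨x, he, rfl⟩
    · rintro ⟨x, hx, rfl⟩
      exact ⟨hx, Sym2.mem_mk_left _ _⟩
  have hcard : N.card = 3 := by
    rw [← hdeg, himg, Finset.card_image_of_injective _ fun x y hxy => Sym2.congr_right.1 hxy]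
  obtain ⟨u, hu⟩ := pointedAt_iff.1 hpt
  have hW : (N.image fun x => x - v).Nonempty := by
    rw [Finset.image_nonempty, ← Finset.card_pos, hcard]; norm_num
  obtain ⟨⟨a', ha', ha⟩, ⟨c', hc', hc⟩⟩ := exists_first_last hW (u := u)
    (by
      intro w hw
      obtain ⟨x, hx, rfl⟩ := Finset.mem_image.1 hw
      exact hu x ((hNmem x).1 hx))
    (by
      intro p hp q hq hpq
      obtain ⟨x, hx, rfl⟩ := Finset.mem_image.1 hp
      obtain ⟨y, hy, rfl⟩ := Finset.mem_image.1 hq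
      obtain ⟨hxP, hvx⟩ := hpairs ((hNmem x).1 hx)
      obtain ⟨hyP, hvy⟩ := hpairs ((hNmem y).1 hy)
      exact det2_ne_zero_of_generalPosition hgen hv hxP hyP hvx hvy
        (by rintro rfl; exact hpq rfl))
  obtain ⟨a, haN, rfl⟩ := Finset.mem_image.1 ha'
  obtain ⟨c, hcN, rfl⟩ := Finset.mem_image.1 hc'
  have hA : ∀ x ∈ N, x ≠ a → 0 < det2 (a - v) (x - v) := fun x hx hxa =>
    ha _ (Finset.mem_image_of_mem _ hx) (by simpa using hxa)
  have hC : ∀ x ∈ N, x ≠ c → 0 < det2 (x - v) (c - v) := fun x hx hxc =>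
    hc _ (Finset.mem_image_of_mem _ hx) (by simpa using hxc)
  have hb : ((N.erase a).erase c).Nonempty := by
    rw [← Finset.card_pos]
    have h1 := Finset.pred_card_le_card_erase (s := N) (a := a)
    have h2 := Finset.pred_card_le_card_erase (s := N.erase a) (a := c)
    omega
  obtain ⟨b, hb⟩ := hb
  obtain ⟨hbc, hb⟩ := Finset.mem_erase.1 hb
  obtain ⟨hba, hbN⟩ := Finset.mem_erase.1 hb
  have hab := hA b hbN hba
  have hbc' := hC b hbN hbc
  have hca : c ≠ a := by
    rintro rfl
    rw [det2_comm] at hab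
    linarith
  refine ⟨a, b, c, fun x => ?_, hab, hA c hcN hca, hbc'⟩
  have hEq : ({a, b, c} : Finset Pt) = N := by
    refine Finset.eq_of_subset_of_card_le ?_ ?_
    · simp [Finset.insert_subset_iff, haN, hbN, hcN]
    · rw [hcard, Finset.card_eq_three.2 ⟨a, b, c, hba.symm, hca.symm, hbc, rfl⟩]
  rw [← hNmem, ← hEq]
  simp

lemma incidentToReflexAngle_of_inner {P : Finset Pt} {G : PlaneGraph P} {v a n : Pt}
    (ha : s(v, a) ∈ G.edges) (hn : n ≠ 0) (h0 : ⟪n, a - v⟫ = 0)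
    (h : ∀ x, s(v, x) ∈ G.edges → x ≠ a → 0 < ⟪n, x - v⟫) :
    IncidentToReflexAngle G v s(v, a) := by
  refine ⟨ha, Sym2.mem_mk_left _ _, n, hn, fun w hw hwv => ?_, fun f hf hvf hfa w hw hwv => ?_⟩
  · rcases Sym2.mem_iff.1 hw with rfl | rfl
    · exact absurd rfl hwv
    · exact h0
  · obtain rfl := (Sym2.mem_and_mem_iff hwv.symm).1 ⟨hvf, hw⟩
    exact h w hf (by rintro rfl; exact hfa rfl)

/-- The flips of the two extremal edges at a vertex of degree three do not both insert an edge at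
that vertex. -/
lemma not_both_flips_incident {P : Finset Pt} (hgen : GeneralPosition P) {G : PlaneGraph P}
    (hG : IsPointedPseudoTriangulation G) {v a b c : Pt}
    (hN : ∀ x, s(v, x) ∈ G.edges ↔ x = a ∨ x = b ∨ x = c) (hab : 0 < det2 (a - v) (b - v))
    (hac : 0 < det2 (a - v) (c - v)) (hbc : 0 < det2 (b - v) (c - v)) {G₁ G₂ : PlaneGraph P}
    {e₁ e₂ : Sym2 Pt} (h₁ : PPTFlip G G₁ s(v, a) e₁) (h₂ : PPTFlip G G₂ s(v, c) e₂)
    (hv₁ : v ∈ e₁) (hv₂ : v ∈ e₂) : False := by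
  obtain ⟨w, hw, u, hu⟩ := h₁.exists_addable hgen hv₁
  obtain ⟨w', hw', u', hu'⟩ := h₂.exists_addable hgen hv₂
  obtain rfl := hw.eq hgen hG hw'
  have hne : ∀ x, s(v, x) ∈ G.edges → w ≠ x := by
    rintro x hx rfl
    exact hw.notMem hx
  have ha := (hN a).2 (by simp)
  have hb := (hN b).2 (by simp)
  have hc := (hN c).2 (by simp)
  obtain ⟨hv, hwP, hvw⟩ := mk_mem_pairs.1 hw.mem_pairs
  obtain ⟨-, haP, hva⟩ := mk_mem_pairs.1 (G.edges_subset_pairs ha)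
  obtain ⟨-, hcP, hvc⟩ := mk_mem_pairs.1 (G.edges_subset_pairs hc)
  have hwmem := Finset.mem_insert_self s(v, w) G.edges
  have hba : b ≠ a := by rintro rfl; simp at hab
  have hca : c ≠ a := by rintro rfl; simp at hac
  have hcb : b ≠ c := by rintro rfl; simp at hbc
  obtain ⟨n, hna, hnb, hnc, hnw⟩ := exists_halfPlane_of_triples hab hac hbc
    (det2_ne_zero_of_generalPosition hgen hv haP hwP hva hvw (hne a ha).symm)
    (det2_ne_zero_of_generalPosition hgen hv hwP hcP hvw hvc (hne c hc))
    (hu b hba (Finset.mem_insert_of_mem hb)) (hu c hca (Finset.mem_insert_of_mem hc))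
    (hu w (hne a ha) hwmem) (hu' a hca.symm (Finset.mem_insert_of_mem ha))
    (hu' b hcb (Finset.mem_insert_of_mem hb)) (hu' w (hne c hc) hwmem)
  have hpt : PointedGraph (G.addEdge hgen _ hw.mem_pairs hw.noncrossing) := by
    intro q hq
    by_cases hqv : q = v
    · rw [hqv]
      refine pointedAt_iff.2 ⟨n, fun x hx => ?_⟩
      rcases Finset.mem_insert.1 hx with hx | hx
      · rwa [Sym2.congr_right.1 hx]
      · rcases (hN x).1 hx with rfl | rfl | rfl <;> assumption
    · exact pointedAt_iff.2 (hw.pointed q hq hqv)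
  have hE := hG.2 _ hpt (Finset.subset_insert _ _)
  exact hw.notMem (hE ▸ hwmem)

lemma PPTFlip.card_filter_mem {P : Finset Pt} {G G' : PlaneGraph P} {v : Pt} {e e' : Sym2 Pt}
    (h : PPTFlip G G' e e') (hve : v ∈ e) (hve' : v ∉ e') :
    (G'.edges.filter fun f => v ∈ f).card = (G.edges.filter fun f => v ∈ f).card - 1 := by
  obtain ⟨-, -, he, -, hE⟩ := h
  rw [hE, Finset.filter_insert, if_neg hve', Finset.filter_erase,
    Finset.card_erase_of_mem (Finset.mem_filter.2 ⟨he, hve⟩)]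

/-- In a pointed pseudo-triangulation, for any (internal) vertex `v` of
degree three, flipping one of the two edges incident to the reflex angle at `v` results
in an edge not incident to `v`, thereby decreasing the degree of `v` to two. -/
theorem degree_three_vertex_flip_decreases_degree
    (P : Finset Pt) (hgen : GeneralPosition P)
    (G : PlaneGraph P) (hG : IsPointedPseudoTriangulation G)
    (v : Pt) (hv : v ∈ P) (hvint : v ∉ hullVertices P)
    (hdeg : (G.edges.filter fun e => v ∈ e).card = 3) :
    ∃ e : Sym2 Pt, IncidentToReflexAngle G v e ∧
      (∃ (G' : PlaneGraph P) (e' : Sym2 Pt), PPTFlip G G' e e') ∧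
      ∀ (G' : PlaneGraph P) (e' : Sym2 Pt), PPTFlip G G' e e' →
        v ∉ e' ∧ (G'.edges.filter fun f => v ∈ f).card = 2 := by
  obtain ⟨a, b, c, hN, hab, hac, hbc⟩ :=
    exists_neighbors_of_degree_three hgen hv (hG.1 v hv) hdeg
  have ha := (hN a).2 (by simp)
  have hc := (hN c).2 (by simp)
  have hva := (mk_mem_pairs.1 (G.edges_subset_pairs ha)).2.2
  have hvc := (mk_mem_pairs.1 (G.edges_subset_pairs hc)).2.2
  have hdeg' : ∀ {x : Pt} {G' : PlaneGraph P} {e' : Sym2 Pt}, PPTFlip G G' s(v, x) e' → v ∉ e' →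
      v ∉ e' ∧ (G'.edges.filter fun f => v ∈ f).card = 2 := fun h hve' =>
    ⟨hve', by rw [h.card_filter_mem (Sym2.mem_mk_left _ _) hve', hdeg]⟩
  by_cases hgood : ∀ (G' : PlaneGraph P) (e' : Sym2 Pt), PPTFlip G G' s(v, a) e' → v ∉ e'
  · refine ⟨s(v, a), incidentToReflexAngle_of_inner ha
      (perp_ne_zero (sub_ne_zero.2 hva.symm)) (by rw [inner_perp, det2_self]) fun x hx hxa => ?_,
      exists_flip_of_interior hgen hG hv hvint ha, fun G' e' h => hdeg' h (hgood G' e' h)⟩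
    rw [inner_perp]
    rcases (hN x).1 hx with rfl | rfl | rfl
    · exact absurd rfl hxa
    · exact hab
    · exact hac
  · push Not at hgood
    obtain ⟨G₁, e₁, h₁, hv₁⟩ := hgood
    refine ⟨s(v, c), incidentToReflexAngle_of_inner hc
      (neg_ne_zero.2 (perp_ne_zero (sub_ne_zero.2 hvc.symm)))
      (by rw [inner_neg_left, inner_perp, det2_self, neg_zero]) fun x hx hxc => ?_,
      exists_flip_of_interior hgen hG hv hvint hc, fun G' e' h => hdeg' h fun hve' =>
        not_both_flips_incident hgen hG hN hab hac hbc h₁ h hv₁ hve'⟩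
    rw [inner_neg_left, inner_perp, ← det2_comm]
    rcases (hN x).1 hx with rfl | rfl | rfl
    · exact hac
    · exact hbc
    · exact absurd rfl hxc
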